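/- Let F be an algebraic closure of the finite field 𝔽_q, let X⁰ be an irreducible scheme of finite type over F defined over 𝔽_q, and let f : X⁰ → X⁰ be a dominant morphism. Then the set of f-quasi-fixed points is Zariski dense in X⁰. -/

import Mathlib

/-!
Corollary 1.3 of Varshavsky, "Intersection of a correspondence with a graph of Frobenius":
for a dominant endomorphism `f` of an irreducible scheme `X⁰` of finite type over
`F = 𝔽_q-bar` that is defined over `𝔽_q`, the set of `f`-quasi-fixed points
(`F`-points `x` with `f(x) = φ_{q^n}(x)` for some `n`) is Zariski dense.
-/

open AlgebraicGeometry CategoryTheory CategoryTheory.Limits TopologicalSpace Opposite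

universe u

/-- `f : X ⟶ X` is the `q`-power Frobenius endomorphism of the scheme `X`: the identity on
the underlying topological space and the `q`-th power map on the structure sheaf. -/
def IsSchemeFrobenius (q : ℕ) {X : Scheme.{u}} (f : X ⟶ X) : Prop :=
  ∃ hb : ∀ x, f.base x = x,
    ∀ (U : X.Opens) (s : Γ(X, U)),
      f.appLE U U (fun x hx => show f.base x ∈ U by rw [hb x]; exact hx) s = s ^ q

/-- The `n`-th iterate of an endomorphism of a scheme. -/
def iterateHom {X : Scheme.{u}} (f : X ⟶ X) : ℕ → (X ⟶ X)
  | 0 => 𝟙 X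
  | n + 1 => f ≫ iterateHom f n

/-- The morphism `Spec F ⟶ Spec 𝔽_q` induced by the algebra structure. -/
noncomputable abbrev specOfAlgebra (Fq F : Type u) [Field Fq] [Field F] [Algebra Fq F] :
    Spec (CommRingCat.of F) ⟶ Spec (CommRingCat.of Fq) :=
  Spec.map (CommRingCat.ofHom (algebraMap Fq F))

/-- Base change of an endomorphism `fr : X₀ ⟶ X₀` over `S` along `g : T ⟶ S`.  Applied to the
`q`-power Frobenius of the `𝔽_q`-model `X₀`, this is the geometric Frobenius `φ_q` of
`X = X₀ ×_{Spec 𝔽_q} Spec F`. -/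
noncomputable def baseChangeEnd {X₀ S T : Scheme.{u}} (sX₀ : X₀ ⟶ S) (g : T ⟶ S)
    (fr : X₀ ⟶ X₀) (hcomm : fr ≫ sX₀ = sX₀) :
    pullback sX₀ g ⟶ pullback sX₀ g :=
  pullback.map sX₀ g sX₀ g fr (𝟙 T) (𝟙 S) (by rw [hcomm, Category.comp_id]) (by simp)

namespace QF

open MvPolynomial in
lemma pow_card_eq_expand {k σ : Type*} [Field k] [Fintype k] (b : MvPolynomial σ k) :
    b ^ Fintype.card k = MvPolynomial.expand (Fintype.card k) b := by
  have : FiniteField.frobeniusAlgHom k (MvPolynomial σ k) =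
      MvPolynomial.expand (Fintype.card k) := by
    ext i : 1
    simp
  exact DFunLike.congr_fun this b

open MvPolynomial Classical in
lemma mono_indep_poly {k σ : Type*} [Field k] [Fintype k] [Fintype σ]
    (b : (σ → Fin (Fintype.card k)) → MvPolynomial σ k)
    (h : ∑ α, b α ^ Fintype.card k * ∏ i, X i ^ (α i : ℕ) = 0) : ∀ α, b α = 0 := by
  intro α₀
  ext m
  have hq : Fintype.card k ≠ 0 := Fintype.card_ne_zero
  let e : (σ → Fin (Fintype.card k)) → (σ →₀ ℕ) := fun α => Finsupp.equivFunOnFinite.symm fun i => (α i : ℕ)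
  have hmon : ∀ α : σ → Fin (Fintype.card k), (∏ i, X i ^ (α i : ℕ) : MvPolynomial σ k) = monomial (e α) 1 := by
    intro α
    rw [MvPolynomial.monomial_eq, Finsupp.prod_fintype _ _ (by simp)]
    simp [e]
  have h1 := congrArg (MvPolynomial.coeff (Fintype.card k • m + e α₀)) h
  rw [MvPolynomial.coeff_sum, Finset.sum_eq_single α₀] at h1
  · rw [hmon, MvPolynomial.coeff_mul_monomial, pow_card_eq_expand,
      MvPolynomial.coeff_expand_smul _ hq] at h1
    simpa using h1
  · intro α _ hα
    rw [hmon, MvPolynomial.coeff_mul_monomial']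
    split_ifs with hle
    · rw [pow_card_eq_expand]
      obtain ⟨i, hi⟩ : ∃ i, α i ≠ α₀ i := by
        by_contra! hcon
        exact hα (funext hcon)
      rw [MvPolynomial.coeff_expand_of_not_dvd (i := i), zero_mul]
      intro hd
      have hle' := hle i
      simp only [e, Finsupp.coe_add, Finsupp.coe_smul, Pi.add_apply, Pi.smul_apply, smul_eq_mul,
        Finsupp.equivFunOnFinite_symm_apply_apply, Finsupp.coe_tsub, Pi.sub_apply] at hd hle'
      have : (α i : ℕ) ≡ Fintype.card k * m i + α₀ i [MOD Fintype.card k] := (Nat.modEq_iff_dvd' hle').2 hd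
      have h2 : (α i : ℕ) ≡ α₀ i [MOD Fintype.card k] := this.trans (by simp [Nat.ModEq])
      exact hi (Fin.ext (Nat.ModEq.eq_of_lt_of_lt h2 (α i).2 (α₀ i).2))
    · rfl
  · simp

open Classical in
lemma mono_indep_field {k K σ : Type*} [Field k] [Fintype k] [Field K] [Algebra k K] [Fintype σ]
    (x : σ → K) (hs : AlgebraicIndependent k x)
    (b : (σ → Fin (Fintype.card k)) → K)
    (hb : ∀ α, b α ∈ IntermediateField.adjoin k (Set.range x))
    (h : ∑ α, b α ^ Fintype.card k * ∏ i, x i ^ (α i : ℕ) = 0) : ∀ α, b α = 0 := by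
  have hinj : Function.Injective (MvPolynomial.aeval (R := k) x) := hs
  have hb' : ∀ α, ∃ r t : MvPolynomial σ k, t ≠ 0 ∧
      b α = MvPolynomial.aeval x r / MvPolynomial.aeval x t := by
    intro α
    obtain ⟨r, t, hrt⟩ := (IntermediateField.mem_adjoin_range_iff k x (b α)).1 (hb α)
    by_cases ht : t = 0
    · exact ⟨0, 1, one_ne_zero, by simp [hrt, ht]⟩
    · exact ⟨r, t, ht, hrt⟩
  choose r t ht hrt using hb'
  have ht' : ∀ α, MvPolynomial.aeval x (t α) ≠ 0 := fun α =>
    (map_ne_zero_iff _ hinj).2 (ht α)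
  obtain ⟨T, hT⟩ : ∃ T, T = ∏ α, t α := ⟨_, rfl⟩
  obtain ⟨c, hcdef⟩ : ∃ c : (σ → Fin (Fintype.card k)) → MvPolynomial σ k, ∀ α, c α =
    r α * ∏ β ∈ Finset.univ.erase α, t β := ⟨_, fun _ => rfl⟩
  have hT0 : MvPolynomial.aeval x T ≠ 0 := by
    rw [hT, map_prod]
    exact Finset.prod_ne_zero_iff.2 fun α _ => ht' α
  have hc : ∀ α, MvPolynomial.aeval x (c α) = MvPolynomial.aeval x T * b α := by
    intro α
    rw [hT, hcdef, ← Finset.mul_prod_erase Finset.univ t (Finset.mem_univ α), map_mul, map_mul,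
      hrt α]
    have := ht' α
    field_simp
  have key : ∑ α, c α ^ Fintype.card k * ∏ i, MvPolynomial.X i ^ (α i : ℕ) = 0 := by
    apply hinj
    simp only [map_sum, map_mul, map_pow, map_prod, MvPolynomial.aeval_X, map_zero, hc]
    simp only [mul_pow, mul_assoc]
    rw [← Finset.mul_sum, h, mul_zero]
  intro α
  have h0 := hc α
  rw [mono_indep_poly c key α, map_zero] at h0
  exact (mul_eq_zero.1 h0.symm).resolve_left hT0

open Classical in
lemma mono_indep {k K σ : Type*} [Field k] [Fintype k] [Field K] [Algebra k K]
    [Fintype σ]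
    (x : σ → K) (hs : AlgebraicIndependent k x)
    (hsep : Algebra.IsSeparable (IntermediateField.adjoin k (Set.range x)) K)
    (b : (σ → Fin (Fintype.card k)) → K)
    (h : ∑ α, b α ^ Fintype.card k * ∏ i, x i ^ (α i : ℕ) = 0) : ∀ α, b α = 0 := by
  obtain ⟨p, hp⟩ := CharP.exists k
  obtain ⟨n, hpp, hcard⟩ := FiniteField.card k p
  have : Fact p.Prime := ⟨hpp⟩
  set L := IntermediateField.adjoin k (Set.range x) with hL
  have : CharP L p := charP_of_injective_algebraMap (algebraMap k L).injective p
  have : ExpChar L p := .prime hpp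
  let B := Module.Basis.ofVectorSpace L K
  let B' := B.mapPowExpCharPowOfIsSeparable p n
  have hB' : ∀ i, B' i = (B i) ^ Fintype.card k := by
    intro i
    simp [B', Module.Basis.mapPowExpCharPowOfIsSeparable, hcard]
  have hrep : ∀ (a : K) (i), B'.repr (a ^ Fintype.card k) i = (B.repr a i) ^ Fintype.card k := by
    intro a i
    have h1 : a ^ Fintype.card k = Finsupp.linearCombination L B'
        ((B.repr a).mapRange (fun x => x ^ Fintype.card k) (by simp [Fintype.card_ne_zero])) := by
      conv_lhs => rw [← B.linearCombination_repr a]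
      rw [Finsupp.linearCombination_apply, Finsupp.linearCombination_apply,
        Finsupp.sum_mapRange_index (by simp)]
      have := map_finsuppSum (FiniteField.frobeniusAlgHom k K) (B.repr a) (fun i r => r • B i)
      rw [FiniteField.coe_frobeniusAlgHom] at this
      simp only [] at this
      rw [this]
      refine Finsupp.sum_congr fun i _ => ?_
      rw [hB', Algebra.smul_def, Algebra.smul_def, mul_pow, map_pow]
    rw [h1, Module.Basis.repr_linearCombination]
    simp
  let m : (σ → Fin (Fintype.card k)) → L := fun α => ∏ i,
    (⟨x i, IntermediateField.subset_adjoin k _ ⟨i, rfl⟩⟩ : L) ^ (α i : ℕ)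
  have hm : ∀ α, (algebraMap L K) (m α) = ∏ i, x i ^ (α i : ℕ) := by
    intro α
    simp only [m, map_prod, map_pow]
    rfl
  have key : ∀ i α, ((B.repr (b α) i : L) : K) = 0 := by
    intro i
    apply mono_indep_field x hs (fun α => ((B.repr (b α) i : L) : K)) (fun α => (B.repr (b α) i).2)
    have h1 := congrArg (fun x => ((B'.repr x i : L) : K)) h
    simp only [map_zero, Finsupp.coe_zero, Pi.zero_apply, map_sum, Finsupp.coe_finsetSum,
      Finset.sum_apply, ZeroMemClass.coe_zero] at h1
    have h2 : ∀ α, B'.repr (b α ^ Fintype.card k * ∏ i, x i ^ (α i : ℕ)) i =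
        (B.repr (b α) i) ^ Fintype.card k * m α := by
      intro α
      rw [← hm, mul_comm, ← Algebra.smul_def, map_smul, Finsupp.smul_apply, hrep, smul_eq_mul, mul_comm]
    simp only [h2] at h1
    have h3 := (map_sum (algebraMap L K) (fun α => (B.repr (b α) i) ^ Fintype.card k * m α) Finset.univ)
    simp only [map_mul, map_pow, hm] at h3
    rw [← h1]
    exact h3.symm
  intro α
  apply B.repr.injective
  ext i
  simpa using key i α

end QF

namespace QF

/-- `K` as a module over itself through the `q`-power map. -/
def FM (k K : Type*) [Field k] [Fintype k] [Field K] [Algebra k K] : Type _ := K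

noncomputable instance (k K : Type*) [Field k] [Fintype k] [Field K] [Algebra k K] :
    AddCommGroup (FM k K) := inferInstanceAs (AddCommGroup K)

noncomputable instance (k K : Type*) [Field k] [Fintype k] [Field K] [Algebra k K] :
    Module K (FM k K) :=
  Module.compHom K (FiniteField.frobeniusAlgHom k K).toRingHom

lemma FM_smul {k K : Type*} [Field k] [Fintype k] [Field K] [Algebra k K] (a b : K) :
    (a • (show FM k K from b) : FM k K) = (a ^ Fintype.card k * b : K) := rfl

lemma exists_psi {k K : Type*} [Field k] [Fintype k] [Field K] [Algebra k K]
    [Algebra.EssFiniteType k K] :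
    ∃ (t : Finset K) (ψ : K →ₗ[k] K), IsTranscendenceBasis k ((↑) : t → K) ∧
      (∀ a b, ψ (a ^ Fintype.card k * b) = a * ψ b) ∧
      (ψ (∏ i : t, (i : K) ^ (Fintype.card k - 1)) = 1) ∧
      (∀ r : t → ℕ, (∀ i, r i < Fintype.card k) → (∃ i, r i ≠ Fintype.card k - 1) →
        ψ (∏ i : t, (i : K) ^ (r i)) = 0) ∧
      Algebra.IsSeparable (IntermediateField.adjoin k (t : Set K)) K := by
  classical
  obtain ⟨t, ht, hsep⟩ := exists_isTranscendenceBasis_and_isSeparable_of_perfectField k K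
  have hq : 0 < Fintype.card k := Fintype.card_pos
  let x : t → K := (↑)
  have hr : Set.range x = t := by simp [x]
  have hsep' : Algebra.IsSeparable (IntermediateField.adjoin k (Set.range x)) K := by
    rw [hr]; exact hsep
  let m : (t → Fin (Fintype.card k)) → FM k K := fun α => (∏ i, x i ^ (α i : ℕ) : K)
  have hli : LinearIndependent K m := by
    rw [Fintype.linearIndependent_iff]
    intro b hb
    refine mono_indep x ht.1 hsep' b ?_
    have hb' : ∑ α, (b α ^ Fintype.card k * ∏ i, x i ^ (α i : ℕ) : K) = 0 := hb
    rw [← hb']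
    congr!
  obtain ⟨g, hg⟩ := (Finsupp.linearCombination K m).exists_leftInverse_of_injective
    (LinearMap.ker_eq_bot.2 hli)
  have hg' : ∀ α, g (m α) = Finsupp.single α 1 := by
    intro α
    have := LinearMap.congr_fun hg (Finsupp.single α 1)
    simpa using this
  let α₀ : t → Fin (Fintype.card k) := fun _ => ⟨Fintype.card k - 1, by omega⟩
  have hadd : ∀ a b : K, g (show FM k K from (a + b : K)) α₀ =
      g (show FM k K from a) α₀ + g (show FM k K from b) α₀ := by
    intro a b
    exact DFunLike.congr_fun (map_add g (show FM k K from a) (show FM k K from b)) α₀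
  have hsm : ∀ a b : K, g (show FM k K from (a ^ Fintype.card k * b : K)) α₀ =
      a * g (show FM k K from b) α₀ := by
    intro a b
    exact DFunLike.congr_fun (map_smul g a (show FM k K from b)) α₀
  refine ⟨t, { toFun := fun a => g (show FM k K from a) α₀
               map_add' := hadd
               map_smul' := ?_ }, ht, hsm, ?_, ?_, hsep⟩
  · intro c b
    have : c • b = (algebraMap k K c) ^ Fintype.card k * b := by
      rw [← map_pow, FiniteField.pow_card, Algebra.smul_def]
    simp only [RingHom.id_apply]
    rw [this, hsm, Algebra.smul_def]
  · have := hg' α₀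
    change g (m α₀) α₀ = 1
    rw [this]; simp
  · intro r hr ⟨i, hi⟩
    have := hg' fun i => ⟨r i, hr i⟩
    change g (m fun i => ⟨r i, hr i⟩) α₀ = 0
    rw [this, Finsupp.single_eq_of_ne]
    intro h
    exact hi (congrArg Fin.val (congrFun h i)).symm

section iter
variable {k K : Type*} [Field k] [Fintype k] [Field K] [Algebra k K] {ψ : K →ₗ[k] K}

lemma psi_iter (hψ : ∀ a b, ψ (a ^ Fintype.card k * b) = a * ψ b) (n : ℕ) (a b : K) :
    (ψ ^ n) (a ^ (Fintype.card k ^ n) * b) = a * (ψ ^ n) b := by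
  induction n generalizing b with
  | zero => simp
  | succ n ih =>
    rw [pow_succ (Fintype.card k), pow_succ ψ, pow_mul, Module.End.mul_apply, hψ, ih]; rfl

variable {σ : Type*} [Fintype σ] {x : σ → K}

lemma psi_mono_one (hψ : ∀ a b, ψ (a ^ Fintype.card k * b) = a * ψ b)
    (h1 : ψ (∏ i, x i ^ (Fintype.card k - 1)) = 1) (n : ℕ) :
    (ψ ^ n) (∏ i, x i ^ (Fintype.card k ^ n - 1)) = 1 := by
  have hq : 0 < Fintype.card k := Fintype.card_pos
  induction n with
  | zero => simp
  | succ n ih =>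
    have : (∏ i, x i ^ (Fintype.card k ^ (n+1) - 1)) =
        (∏ i, x i ^ (Fintype.card k ^ n - 1)) ^ Fintype.card k *
          ∏ i, x i ^ (Fintype.card k - 1) := by
      rw [← Finset.prod_pow, ← Finset.prod_mul_distrib]
      refine Finset.prod_congr rfl fun i _ => ?_
      rw [← pow_mul, ← pow_add]
      congr 1
      have : 0 < Fintype.card k ^ n := by positivity
      rw [pow_succ, Nat.sub_mul, one_mul]
      have := Nat.le_mul_of_pos_left (Fintype.card k) this
      omega
    rw [pow_succ ψ, this, Module.End.mul_apply, hψ, h1, mul_one, ih]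

lemma psi_mono_zero (hψ : ∀ a b, ψ (a ^ Fintype.card k * b) = a * ψ b)
    (h1 : ψ (∏ i, x i ^ (Fintype.card k - 1)) = 1)
    (h0 : ∀ r : σ → ℕ, (∀ i, r i < Fintype.card k) → (∃ i, r i ≠ Fintype.card k - 1) →
        ψ (∏ i, x i ^ (r i)) = 0) (n : ℕ) (δ : σ → ℕ)
    (hδ : ∃ i, ¬ Fintype.card k ^ n ∣ δ i + 1) :
    (ψ ^ n) (∏ i, x i ^ δ i) = 0 := by
  have hq : 0 < Fintype.card k := Fintype.card_pos
  induction n generalizing δ with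
  | zero => simp at hδ
  | succ n ih =>
    have : (∏ i, x i ^ δ i) = (∏ i, x i ^ (δ i / Fintype.card k)) ^ Fintype.card k *
          ∏ i, x i ^ (δ i % Fintype.card k) := by
      rw [← Finset.prod_pow, ← Finset.prod_mul_distrib]
      refine Finset.prod_congr rfl fun i _ => ?_
      rw [← pow_mul, ← pow_add, Nat.div_add_mod']
    rw [pow_succ ψ, this, Module.End.mul_apply, hψ]
    by_cases hr : ∃ i, δ i % Fintype.card k ≠ Fintype.card k - 1
    · rw [h0 _ (fun i => Nat.mod_lt _ hq) hr, mul_zero, map_zero]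
    · push Not at hr
      simp only [hr, h1, mul_one]
      apply ih
      obtain ⟨i, hi⟩ := hδ
      refine ⟨i, fun hd => hi ?_⟩
      have h3 : δ i + 1 = (δ i / Fintype.card k + 1) * Fintype.card k := by
        have := Nat.div_add_mod' (δ i) (Fintype.card k)
        rw [hr i] at this
        rw [add_mul, one_mul]; omega
      rw [h3, pow_succ]
      exact Nat.mul_dvd_mul_right hd _

lemma psi_test (hψ : ∀ a b, ψ (a ^ Fintype.card k * b) = a * ψ b)
    (h1 : ψ (∏ i, x i ^ (Fintype.card k - 1)) = 1)
    (h0 : ∀ r : σ → ℕ, (∀ i, r i < Fintype.card k) → (∃ i, r i ≠ Fintype.card k - 1) →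
        ψ (∏ i, x i ^ (r i)) = 0) (P : MvPolynomial σ k) (hP : P ≠ 0) :
    ∃ N, ∀ n ≥ N, ∃ γ : σ → ℕ, (∀ i, γ i < Fintype.card k ^ n) ∧ ∃ c : k, c ≠ 0 ∧
      (ψ ^ n) (MvPolynomial.aeval x P * ∏ i, x i ^ γ i) = algebraMap k K c := by
  classical
  obtain ⟨α, hα⟩ := MvPolynomial.support_nonempty.2 hP
  refine ⟨P.totalDegree, fun n hn => ?_⟩
  have hQ : P.totalDegree < Fintype.card k ^ n :=
    lt_of_le_of_lt hn (Nat.lt_pow_self (Fintype.one_lt_card))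
  have hdeg : ∀ β ∈ P.support, ∀ i, β i < Fintype.card k ^ n := by
    intro β hβ i
    refine lt_of_le_of_lt ?_ hQ
    refine le_trans ?_ (MvPolynomial.le_totalDegree hβ)
    by_cases hi : β i = 0
    · rw [hi]; exact Nat.zero_le _
    · exact Finset.single_le_sum (f := fun i => β i) (fun _ _ => Nat.zero_le _)
        (Finsupp.mem_support_iff.2 hi)
  refine ⟨fun i => Fintype.card k ^ n - 1 - α i, fun i => ?_, P.coeff α,
    MvPolynomial.mem_support_iff.1 hα, ?_⟩
  · have := hdeg α hα i
    show Fintype.card k ^ n - 1 - α i < _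
    omega
  · rw [MvPolynomial.aeval_def, MvPolynomial.eval₂_eq', Finset.sum_mul, map_sum,
      Finset.sum_eq_single_of_mem α hα]
    · rw [mul_assoc, ← Algebra.smul_def, map_smul, ← Finset.prod_mul_distrib, Algebra.smul_def]
      have : ∏ i, x i ^ α i * x i ^ (Fintype.card k ^ n - 1 - α i) =
          ∏ i, x i ^ (Fintype.card k ^ n - 1) := by
        refine Finset.prod_congr rfl fun i _ => ?_
        rw [← pow_add]; congr 1
        have := hdeg α hα i; omega
      rw [this, psi_mono_one hψ h1, mul_one]
    · intro β hβ hne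
      rw [mul_assoc, ← Algebra.smul_def, map_smul, ← Finset.prod_mul_distrib]
      simp only [← pow_add]
      rw [psi_mono_zero hψ h1 h0, smul_zero]
      obtain ⟨i, hi⟩ : ∃ i, β i ≠ α i := by
        by_contra! hcon
        exact hne (Finsupp.ext hcon)
      refine ⟨i, ?_⟩
      have hb := hdeg β hβ i
      have ha := hdeg α hα i
      rintro ⟨c, hc⟩
      rcases Nat.lt_trichotomy c 1 with h | h | h
      · have : c = 0 := by omega
        subst this; omega
      · subst h; omega
      · have := Nat.mul_le_mul_left (Fintype.card k ^ n) h
        omega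

end iter
end QF

namespace QF

section filt
variable {k K : Type*} [Field k] [Field K] [Algebra k K]

lemma pow_mono_sub {V : Submodule k K} (h1 : (1 : K) ∈ V) {i j : ℕ} (h : i ≤ j) :
    V ^ i ≤ V ^ j :=
  pow_le_pow_right₀ (Submodule.one_le.2 h1) h

lemma mul_mem_pow {V : Submodule k K} {i j : ℕ} {a b : K} (ha : a ∈ V ^ i) (hb : b ∈ V ^ j) :
    a * b ∈ V ^ (i + j) := by
  rw [pow_add]; exact Submodule.mul_mem_mul ha hb

lemma pow_mem_pow' {V : Submodule k K} {i : ℕ} {a : K} (ha : a ∈ V ^ i) (j : ℕ) :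
    a ^ j ∈ V ^ (i * j) := by
  rw [pow_mul]; exact Submodule.pow_mem_pow _ ha j

lemma prod_mem_pow {σ : Type*} [Fintype σ] {V : Submodule k K} {x : σ → K} (hx : ∀ i, x i ∈ V)
    (γ : σ → ℕ) : ∏ i, x i ^ γ i ∈ V ^ (∑ i, γ i) := by
  classical
  have : ∀ s : Finset σ, ∏ i ∈ s, x i ^ γ i ∈ V ^ (∑ i ∈ s, γ i) := by
    intro s
    induction s using Finset.induction_on with
    | empty => simp
    | insert a s ha ih =>
      rw [Finset.prod_insert ha, Finset.sum_insert ha]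
      exact mul_mem_pow (Submodule.pow_mem_pow _ (hx a) _) ih
  exact this _

lemma span_pow_le {σ : Type*} [Fintype σ] (x : σ → K) (j : ℕ) :
    (Submodule.span k (Set.range x)) ^ j ≤
      Submodule.span k {a | ∃ γ : σ → ℕ, ∑ i, γ i = j ∧ a = ∏ i, x i ^ γ i} := by
  classical
  induction j with
  | zero =>
    rw [pow_zero, Submodule.one_le]
    exact Submodule.subset_span ⟨0, by simp, by simp⟩
  | succ j ih =>
    rw [pow_succ]
    refine (mul_le_mul' ih le_rfl).trans ?_
    rw [Submodule.span_mul_span, Submodule.span_le]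
    rintro _ ⟨_, ⟨γ, hγ, rfl⟩, _, ⟨i, rfl⟩, rfl⟩
    refine Submodule.subset_span ⟨γ + Pi.single i 1, ?_, ?_⟩
    · simp [Finset.sum_add_distrib, hγ]
    · have : ∏ j, x j ^ (Pi.single i 1 : σ → ℕ) j = x i := by
        rw [Finset.prod_eq_single i (fun j _ hj => by simp [Pi.single_eq_of_ne hj]) (by simp)]
        simp
      simp only [Pi.add_apply, pow_add, Finset.prod_mul_distrib, this]

lemma mem_adjoin_pow {V : Submodule k K} (h1 : (1 : K) ∈ V) {a : K}
    (ha : a ∈ Algebra.adjoin k (V : Set K)) : ∃ i, a ∈ V ^ i := by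
  induction ha using Algebra.adjoin_induction with
  | mem x hx => exact ⟨1, by simpa using hx⟩
  | algebraMap r => exact ⟨0, by simp [Submodule.mem_one]⟩
  | add x y _ _ hx hy =>
    obtain ⟨i, hi⟩ := hx
    obtain ⟨j, hj⟩ := hy
    exact ⟨i + j, add_mem (pow_mono_sub h1 (by omega) hi) (pow_mono_sub h1 (by omega) hj)⟩
  | mul x y _ _ hx hy =>
    obtain ⟨i, hi⟩ := hx
    obtain ⟨j, hj⟩ := hy
    exact ⟨i + j, mul_mem_pow hi hj⟩

lemma common_pow {V : Submodule k K} (h1 : (1 : K) ∈ V) {ι : Type*} [Finite ι] (a : ι → K)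
    (h : ∀ i, ∃ n, a i ∈ V ^ n) : ∃ n, ∀ i, a i ∈ V ^ n := by
  cases nonempty_fintype ι
  choose n hn using h
  exact ⟨∑ i, n i, fun i => pow_mono_sub h1
    (Finset.single_le_sum (f := n) (fun _ _ => Nat.zero_le _) (Finset.mem_univ i)) (hn i)⟩

end filt

section psi
variable {k K : Type*} [Field k] [Fintype k] [Field K] [Algebra k K] {ψ : K →ₗ[k] K}

lemma psi_mono_split (hψ : ∀ a b, ψ (a ^ Fintype.card k * b) = a * ψ b)
    {σ : Type*} [Fintype σ] (x : σ → K) (γ : σ → ℕ) :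
    ψ (∏ i, x i ^ γ i) = (∏ i, x i ^ (γ i / Fintype.card k)) *
      ψ (∏ i, x i ^ (γ i % Fintype.card k)) := by
  rw [← hψ]
  congr 1
  rw [← Finset.prod_pow, ← Finset.prod_mul_distrib]
  refine Finset.prod_congr rfl fun i _ => ?_
  rw [← pow_mul, ← pow_add, Nat.div_add_mod']

/-- growth bound for `ψ` -/
lemma psi_growth (hψ : ∀ a b, ψ (a ^ Fintype.card k * b) = a * ψ b)
    {σ : Type*} [Fintype σ] (x : σ → K) (h1 : (1 : K) ∈ Submodule.span k (Set.range x))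
    (hA : ∀ r : σ → Fin (Fintype.card k), ∃ n,
      ψ (∏ i, x i ^ (r i : ℕ)) ∈ (Submodule.span k (Set.range x)) ^ n) :
    ∃ C, ∀ j, ∀ b ∈ (Submodule.span k (Set.range x)) ^ j,
      ψ b ∈ (Submodule.span k (Set.range x)) ^ (j / Fintype.card k + C) := by
  classical
  have hq : 0 < Fintype.card k := Fintype.card_pos
  obtain ⟨C, hC⟩ := common_pow h1 (fun r : σ → Fin (Fintype.card k) =>
    ψ (∏ i, x i ^ (r i : ℕ))) hA
  refine ⟨C, fun j b hb => ?_⟩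
  have hb' := span_pow_le x j hb
  refine Submodule.span_induction (p := fun b _ => ψ b ∈ (Submodule.span k (Set.range x)) ^
    (j / Fintype.card k + C)) ?_ ?_ ?_ ?_ hb'
  · rintro _ ⟨γ, hγ, rfl⟩
    rw [psi_mono_split hψ]
    refine mul_mem_pow ?_ (hC fun i => ⟨γ i % Fintype.card k, Nat.mod_lt _ hq⟩)
    refine pow_mono_sub h1 ?_ (prod_mem_pow
      (fun i => Submodule.subset_span (Set.mem_range_self i)) _)
    rw [← hγ, Nat.le_div_iff_mul_le hq, Finset.sum_mul]
    exact Finset.sum_le_sum fun i _ => Nat.div_mul_le_self _ _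
  · simp
  · intro a b _ _ ha hb
    rw [map_add]; exact add_mem ha hb
  · intro c a _ ha
    rw [map_smul]; exact Submodule.smul_mem _ _ ha

lemma psi_growth_iter {V : Submodule k K} (h1 : (1 : K) ∈ V) {C : ℕ}
    (hC : ∀ j, ∀ b ∈ V ^ j, ψ b ∈ V ^ (j / Fintype.card k + C)) (n : ℕ) :
    ∀ j, ∀ b ∈ V ^ j, (ψ ^ n) b ∈ V ^ (j / Fintype.card k ^ n + 2 * C) := by
  have hq : 1 < Fintype.card k := Fintype.one_lt_card
  induction n with
  | zero => intro j b hb; exact pow_mono_sub h1 (by simp) hb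
  | succ n ih =>
    intro j b hb
    rw [pow_succ' ψ, Module.End.mul_apply]
    refine pow_mono_sub h1 ?_ (hC _ _ (ih j b hb))
    rw [pow_succ, ← Nat.div_div_eq_div_mul]
    have h2 : (j / Fintype.card k ^ n + 2 * C) / Fintype.card k ≤
        (j / Fintype.card k ^ n + C * Fintype.card k) / Fintype.card k :=
      Nat.div_le_div_right (by nlinarith)
    rw [Nat.add_mul_div_right _ _ (by omega)] at h2
    omega

end psi

end QF

namespace QF

/-- The data used in the trace argument. -/
structure Setup {k K : Type*} [Field k] [Fintype k] [Field K] [Algebra k K]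
    (ψ : K →ₗ[k] K) (V : Submodule k K) (C d : ℕ) : Prop where
  hψ : ∀ a b, ψ (a ^ Fintype.card k * b) = a * ψ b
  fg : V.FG
  one : (1 : K) ∈ V
  growth : ∀ n j, ∀ b ∈ V ^ j, (ψ ^ n) b ∈ V ^ (j / Fintype.card k ^ n + C)
  test : ∀ i, ∀ s ∈ V ^ i, s ≠ 0 → ∃ e N, ∀ n ≥ N, ∃ g ∈ V ^ (e + d * Fintype.card k ^ n),
    (ψ ^ n) (s * g) = 1
  frac : ∀ a : K, ∃ s ≠ 0, ∃ i, s ∈ V ^ i ∧ a * s ∈ V ^ i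

variable {k K : Type*} [Field k] [Fintype k] [Field K] [Algebra k K]


lemma pow_le_adjoin {k K : Type*} [Field k] [Field K] [Algebra k K] {V : Submodule k K} (i : ℕ) :
    V ^ i ≤ Subalgebra.toSubmodule (Algebra.adjoin k (V : Set K)) := by
  induction i with
  | zero => rw [pow_zero, Submodule.one_le]; exact one_mem (Algebra.adjoin k (V : Set K))
  | succ i ih =>
    rw [pow_succ, Submodule.mul_le]
    intro a ha b hb
    exact mul_mem (S := Subalgebra k K) (ih ha) (Algebra.subset_adjoin hb)

lemma exists_delta {ψ : K →ₗ[k] K} (hψ : ∀ a b, ψ (a ^ Fintype.card k * b) = a * ψ b)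
    (T : Finset K)
    (hfr : ∀ a : K, ∃ s ∈ Algebra.adjoin k (T : Set K), s ≠ 0 ∧
      a * s ∈ Algebra.adjoin k (T : Set K)) :
    ∃ δ ∈ Algebra.adjoin k (T : Set K), δ ≠ 0 ∧ ∀ a ∈ Algebra.adjoin k (T : Set K),
      ψ a * δ ∈ Algebra.adjoin k (T : Set K) := by
  classical
  have hq : 0 < Fintype.card k := Fintype.card_pos
  let x : T → K := (↑)
  choose s hs hs0 hs1 using fun r : T → Fin (Fintype.card k) => hfr (ψ (∏ i, x i ^ (r i : ℕ)))
  have hδ : ∀ r : T → Fin (Fintype.card k), ψ (∏ i, x i ^ (r i : ℕ)) * ∏ r, s r ∈ Algebra.adjoin k (T : Set K) := by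
    intro r
    rw [← Finset.mul_prod_erase Finset.univ s (Finset.mem_univ r), ← mul_assoc]
    exact mul_mem (hs1 r) (prod_mem fun i _ => hs i)
  refine ⟨∏ r, s r, prod_mem fun r _ => hs r, Finset.prod_ne_zero_iff.2 fun r _ => hs0 r, ?_⟩
  intro a ha
  have hr : (T : Set K) = Set.range x := by simp [x]
  have ha' := ha
  rw [hr, Algebra.adjoin_range_eq_range_aeval] at ha'
  obtain ⟨P, rfl⟩ := ha'
  change ψ (MvPolynomial.aeval x P) * _ ∈ _
  rw [MvPolynomial.aeval_def, MvPolynomial.eval₂_eq', map_sum, Finset.sum_mul]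
  refine sum_mem fun γ _ => ?_
  rw [← Algebra.smul_def, map_smul, psi_mono_split hψ, smul_mul_assoc, mul_assoc]
  refine Subalgebra.smul_mem _ (mul_mem ?_ ?_) _
  · exact prod_mem fun i _ => pow_mem (Algebra.subset_adjoin i.2) _
  · exact hδ fun i => ⟨γ i % Fintype.card k, Nat.mod_lt _ hq⟩

lemma exists_setup [Algebra.EssFiniteType k K] (S : Finset K) :
    ∃ (ψ : K →ₗ[k] K) (V : Submodule k K) (C d : ℕ), Setup ψ V C d ∧ (S : Set K) ⊆ V := by
  classical
  have hq : 0 < Fintype.card k := Fintype.card_pos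
  obtain ⟨t, ψ, ht, hψ, h1, h0, _⟩ := exists_psi (k := k) (K := K)
  obtain ⟨G, hG⟩ := IntermediateField.fg_top k K
  let T : Finset K := S ∪ G ∪ t
  have hfr : ∀ a : K, ∃ s ∈ Algebra.adjoin k (T : Set K), s ≠ 0 ∧
      a * s ∈ Algebra.adjoin k (T : Set K) := by
    intro a
    have ha : a ∈ IntermediateField.adjoin k (T : Set K) := by
      have : IntermediateField.adjoin k (G : Set K) ≤ IntermediateField.adjoin k (T : Set K) :=
        IntermediateField.adjoin.mono _ _ _ (by intro y hy; simp [T]; tauto)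
      apply this; rw [hG]; trivial
    obtain ⟨r, hr, s, hs, rfl⟩ := IntermediateField.mem_adjoin_iff_div.1 ha
    by_cases h : s = 0
    · exact ⟨1, one_mem _, one_ne_zero, by simp [h]⟩
    · exact ⟨s, hs, h, by rwa [div_mul_cancel₀ _ h]⟩
  obtain ⟨δ, hδ, hδ0, hδψ⟩ := exists_delta hψ T hfr
  let T' : Finset K := insert 1 (insert δ⁻¹ T)
  let x : T' → K := (↑)
  have hx : Set.range x = T' := by simp [x]
  let V : Submodule k K := Submodule.span k (Set.range x)
  have hTV : ∀ a ∈ T', a ∈ V := fun a ha => Submodule.subset_span (by rw [hx]; exact ha)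
  have one : (1 : K) ∈ V := hTV _ (by simp [T'])
  have hVA : ∀ i, ∀ a ∈ V ^ i, a ∈ Algebra.adjoin k (V : Set K) := by
    exact fun i a ha => pow_le_adjoin i ha
  have hAA : ∀ a ∈ Algebra.adjoin k (T : Set K), a ∈ Algebra.adjoin k (V : Set K) := by
    intro a ha
    refine Algebra.adjoin_mono ?_ ha
    intro y hy
    exact hTV y (by simp [T']; right; right; exact hy)
  have hδA : δ⁻¹ ∈ Algebra.adjoin k (V : Set K) :=
    Algebra.subset_adjoin (hTV _ (by simp [T']))
  have hA1 : ∀ a i, a * δ ^ i ∈ Algebra.adjoin k (T : Set K) →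
      a ∈ Algebra.adjoin k (V : Set K) := by
    intro a i h
    have : a = (a * δ ^ i) * (δ⁻¹) ^ i := by
      rw [mul_assoc, ← mul_pow, mul_inv_cancel₀ hδ0, one_pow, mul_one]
    rw [this]
    exact mul_mem (hAA _ h) (pow_mem hδA _)
  have hA2 : ∀ a ∈ Algebra.adjoin k (V : Set K), ∃ i, ∀ j ≥ i,
      a * δ ^ j ∈ Algebra.adjoin k (T : Set K) := by
    intro a ha
    have : Algebra.adjoin k (V : Set K) = Algebra.adjoin k (T' : Set K) := by
      rw [← hx]; exact Algebra.adjoin_span k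
    rw [this] at ha
    induction ha using Algebra.adjoin_induction with
    | mem y hy =>
      simp only [T', Finset.coe_insert, Set.mem_insert_iff] at hy
      rcases hy with rfl | rfl | hy
      · exact ⟨0, fun j _ => by simpa using pow_mem hδ j⟩
      · refine ⟨1, fun j hj => ?_⟩
        obtain ⟨j, rfl⟩ : ∃ i, j = i + 1 := ⟨j - 1, by omega⟩
        rw [pow_succ', inv_mul_cancel_left₀ hδ0]
        exact pow_mem hδ _
      · exact ⟨0, fun j _ => mul_mem (Algebra.subset_adjoin hy) (pow_mem hδ j)⟩
    | algebraMap r => exact ⟨0, fun j _ => mul_mem (Subalgebra.algebraMap_mem _ _) (pow_mem hδ j)⟩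
    | add y z _ _ hy hz =>
      obtain ⟨i, hi⟩ := hy
      obtain ⟨i', hi'⟩ := hz
      refine ⟨i + i', fun j hj => ?_⟩
      rw [add_mul]
      exact add_mem (hi j (by omega)) (hi' j (by omega))
    | mul y z _ _ hy hz =>
      obtain ⟨i, hi⟩ := hy
      obtain ⟨i', hi'⟩ := hz
      refine ⟨i + i', fun j hj => ?_⟩
      obtain ⟨l, rfl⟩ : ∃ l, j = i + l := ⟨j - i, by omega⟩
      have : y * z * δ ^ (i + l) = (y * δ ^ i) * (z * δ ^ l) := by ring
      rw [this]
      exact mul_mem (hi i le_rfl) (hi' l (by omega))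
  have hψA : ∀ a ∈ Algebra.adjoin k (V : Set K), ψ a ∈ Algebra.adjoin k (V : Set K) := by
    intro a ha
    obtain ⟨i, hi⟩ := hA2 a ha
    apply hA1 _ (i + 1)
    have : ψ a * δ ^ (i + 1) = ψ (a * δ ^ (i * Fintype.card k)) * δ := by
      rw [mul_comm a, pow_mul, hψ]; ring
    rw [this]
    exact hδψ _ (hi _ (Nat.le_mul_of_pos_right _ hq))
  obtain ⟨C, hC⟩ := psi_growth hψ x one (fun r => mem_adjoin_pow one (hψA _
    (prod_mem fun i _ => pow_mem (Algebra.subset_adjoin (hTV _ i.2)) _)))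
  have htV : ∀ i : t, (i : K) ∈ V := fun i => hTV _ (by simp [T', T])
  refine ⟨ψ, V, 2 * C, Fintype.card t, ⟨hψ, ?_, one, psi_growth_iter one hC, ?_, ?_⟩, ?_⟩
  · exact Submodule.fg_span (Set.finite_range x)
  · intro i s hs hs0
    have halg := ht.isAlgebraic
    obtain ⟨r, hr, c, hc0, hc⟩ := (halg.isAlgebraic s).exists_nonzero_eq_adjoin_mul
      (mem_nonZeroDivisors_of_ne_zero hs0)
    have hrA : r ∈ Algebra.adjoin k (V : Set K) := by
      have hB : ∀ b : Algebra.adjoin k (Set.range ((↑) : t → K)),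
          (b : K) ∈ Algebra.adjoin k (V : Set K) := fun b =>
        Algebra.adjoin_mono (by rintro _ ⟨i, rfl⟩; exact htV i) b.2
      clear hc
      induction hr using Algebra.adjoin_induction with
      | mem y hy => rw [Set.mem_singleton_iff.1 hy]; exact hVA i s hs
      | algebraMap b => exact hB b
      | add y z _ _ hy hz => exact add_mem hy hz
      | mul y z _ _ hy hz => exact mul_mem hy hz
    obtain ⟨e, he⟩ := mem_adjoin_pow one hrA
    obtain ⟨P, hP⟩ := (Algebra.adjoin_range_eq_range_aeval k ((↑) : t → K)).le c.2
    have hP0 : P ≠ 0 := by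
      rintro rfl
      apply hc0
      apply Subtype.ext
      rw [← hP]; simp
    obtain ⟨N, hN⟩ := psi_test (x := ((↑) : t → K)) hψ h1 h0 P hP0
    refine ⟨e, N, fun n hn => ?_⟩
    obtain ⟨γ, hγ, a, ha0, ha⟩ := hN n hn
    refine ⟨a⁻¹ • (r * ∏ i : t, (i : K) ^ γ i), Submodule.smul_mem _ _ (mul_mem_pow he
      (pow_mono_sub one ?_ (prod_mem_pow htV γ))), ?_⟩
    · calc ∑ i, γ i ≤ ∑ i : t, Fintype.card k ^ n := Finset.sum_le_sum fun i _ => (hγ i).le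
        _ = _ := by simp
    · rw [mul_smul_comm, map_smul, ← mul_assoc, hc]
      change _ • (ψ ^ n) ((c : K) * _) = 1
      rw [← hP]
      change _ • (ψ ^ n) (MvPolynomial.aeval _ P * _) = 1
      rw [ha, Algebra.smul_def, ← map_mul, inv_mul_cancel₀ ha0, map_one]
  · intro a
    obtain ⟨s, hs, hs0, hs1⟩ := hfr a
    obtain ⟨i, hi⟩ := mem_adjoin_pow one (hAA _ hs)
    obtain ⟨j, hj⟩ := mem_adjoin_pow one (hAA _ hs1)
    exact ⟨s, hs0, i + j, pow_mono_sub one (by omega) hi, pow_mono_sub one (by omega) hj⟩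
  · intro y hy
    refine hTV _ ?_
    have : y ∈ S := hy
    simp [T', T, this]

end QF

namespace QF

/-- The `q ^ n`-power map as an algebra homomorphism. -/
noncomputable def Fr (k R : Type*) [Field k] [Fintype k] [CommRing R] [Algebra k R] (n : ℕ) :
    R →ₐ[k] R := FiniteField.frobeniusAlgHom k R ^ n

lemma Fr_apply {k R : Type*} [Field k] [Fintype k] [CommRing R] [Algebra k R] (n : ℕ) (a : R) :
    Fr k R n a = a ^ (Fintype.card k ^ n) := by
  induction n generalizing a with
  | zero => simp [Fr]
  | succ n ih =>
    have : Fr k R (n + 1) a = Fr k R n (a ^ Fintype.card k) := by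
      unfold Fr; rw [pow_succ]; rfl
    rw [this, ih, ← pow_mul, pow_succ' (Fintype.card k)]

variable {k K : Type*} [Field k] [Fintype k] [Field K] [Algebra k K]

lemma sub_pow_q (n : ℕ) (a b : K) :
    (a - b) ^ (Fintype.card k ^ n) = a ^ (Fintype.card k ^ n) - b ^ (Fintype.card k ^ n) := by
  rw [← Fr_apply (k := k), map_sub, Fr_apply, Fr_apply]

lemma const_alg {ψ : K →ₗ[k] K} {V : Submodule k K} {C d : ℕ} (hS : Setup ψ V C d) (a : K)
    (h : ∀ n, ∃ b : K, b ^ (Fintype.card k ^ n) = a) : IsAlgebraic k a := by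
  have hq : 1 < Fintype.card k := Fintype.one_lt_card
  obtain ⟨s, hs0, i, hs, has⟩ := hS.frac a
  obtain ⟨e, N, hN⟩ := hS.test i s hs hs0
  choose b hb using h
  have key : ∀ n ≥ N, b n ∈ V ^ (i + e + d + C) := by
    intro n hn
    obtain ⟨g, hg, hsg⟩ := hN n hn
    have h1 : b n = (ψ ^ n) (a * s * g) := by
      rw [← hb n, mul_assoc, psi_iter hS.hψ, hsg, mul_one]
    rw [h1]
    refine pow_mono_sub hS.one ?_ (hS.growth n _ _ (mul_mem_pow has hg))
    have hQ : 0 < Fintype.card k ^ n := by positivity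
    rw [← add_assoc, Nat.add_mul_div_right _ _ hQ]
    have := Nat.div_le_self (i + e) (Fintype.card k ^ n)
    omega
  have hfin : Finite (V ^ (i + e + d + C) : Submodule k K) := by
    have : Module.Finite k (V ^ (i + e + d + C) : Submodule k K) :=
      Module.Finite.of_fg (hS.fg.pow _)
    exact Module.finite_of_finite k
  obtain ⟨n, m, hnm, heq⟩ := Finite.exists_ne_map_eq_of_infinite
    (fun n : ℕ => (⟨b (N + n), key _ (by omega)⟩ : (V ^ (i + e + d + C) : Submodule k K)))
  have heq' : b (N + n) = b (N + m) := congrArg Subtype.val heq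
  have main : ∀ n m, n < m → b (N + n) = b (N + m) → IsAlgebraic k a := by
    intro n m hlt he
    refine ⟨Polynomial.X ^ (Fintype.card k ^ (m - n)) - Polynomial.X,
      FiniteField.X_pow_card_pow_sub_X_ne_zero k (by omega) hq, ?_⟩
    simp only [map_sub, map_pow, Polynomial.aeval_X]
    rw [sub_eq_zero]
    conv_lhs => rw [← hb (N + n), ← pow_mul, ← pow_add, he]
    rw [show N + n + (m - n) = N + m by omega, hb]
  rcases lt_or_gt_of_ne hnm with h | h
  · exact main n m h heq'
  · exact main m n h heq'.symm

lemma sep_family {ψ : K →ₗ[k] K} {V : Submodule k K} {C d : ℕ} (hS : Setup ψ V C d)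
    (hconst : ∀ a : K, IsAlgebraic k a → a ∈ Set.range (algebraMap k K)) (r : ℕ) :
    ∀ F : Fin r → K, LinearIndependent k F → ∃ n₀, ∀ n ≥ n₀, ∀ μ : Fin r → K,
      ∑ i, μ i ^ (Fintype.card k ^ n) * F i = 0 → μ = 0 := by
  induction r with
  | zero => intro F _; exact ⟨0, fun n _ μ _ => Subsingleton.elim _ _⟩
  | succ r ih =>
    intro F hF
    rw [linearIndependent_finSucc] at hF
    obtain ⟨n₀, hn₀⟩ := ih _ hF.1
    by_contra! hcon
    have h1 : ∀ n ≥ n₀, ∃ ν : Fin r → K,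
        F 0 = ∑ i, ν i ^ (Fintype.card k ^ n) * F i.succ := by
      intro n hn
      obtain ⟨m, hm, μ, hμ, hμ0⟩ := hcon n
      rw [Fin.sum_univ_succ] at hμ
      have h0 : μ 0 ≠ 0 := by
        intro h0
        apply hμ0
        rw [h0, zero_pow (by positivity), zero_mul, zero_add] at hμ
        have := hn₀ m (by omega) (fun i => μ i.succ) hμ
        funext i
        refine Fin.cases h0 (fun j => ?_) i
        exact congrFun this j
      refine ⟨fun i => (- (μ i.succ / μ 0)) ^ (Fintype.card k ^ (m - n)), ?_⟩
      have hsum : ∑ i : Fin r, ((- (μ i.succ / μ 0)) ^ (Fintype.card k ^ (m - n))) ^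
          (Fintype.card k ^ n) * F i.succ = - (∑ i : Fin r, μ i.succ ^ (Fintype.card k ^ m) * F i.succ) /
            μ 0 ^ (Fintype.card k ^ m) := by
        rw [← Finset.sum_neg_distrib, Finset.sum_div]
        refine Finset.sum_congr rfl fun i _ => ?_
        rw [← pow_mul, ← pow_add, Nat.sub_add_cancel hm, ← zero_sub, sub_pow_q, zero_pow (by positivity),
          div_pow]
        ring
      rw [hsum]
      have : μ 0 ^ (Fintype.card k ^ m) ≠ 0 := pow_ne_zero _ h0
      rw [eq_div_iff this]
      linear_combination hμ
    choose! ν hν using h1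
    have h2 : ∀ n ≥ n₀, ∀ i, ν n i ^ (Fintype.card k ^ n) = ν n₀ i ^ (Fintype.card k ^ n₀) := by
      intro n hn
      have := hn₀ n₀ le_rfl (fun i => ν n i ^ (Fintype.card k ^ (n - n₀)) - ν n₀ i) (by
        have e1 := hν n hn
        have e2 := hν n₀ le_rfl
        have e3 : ∀ i, (ν n i ^ (Fintype.card k ^ (n - n₀)) - ν n₀ i) ^ (Fintype.card k ^ n₀) * Fin.tail F i
          = ν n i ^ (Fintype.card k ^ n) * F i.succ -
            ν n₀ i ^ (Fintype.card k ^ n₀) * F i.succ := by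
          intro i
          rw [sub_pow_q, ← pow_mul, ← pow_add, Nat.sub_add_cancel hn, sub_mul]; rfl
        rw [Finset.sum_congr rfl fun i _ => e3 i, Finset.sum_sub_distrib, ← e1, ← e2, sub_self])
      intro i
      have h3 := congrFun this i
      simp only [Pi.zero_apply, sub_eq_zero] at h3
      rw [← h3, ← pow_mul, ← pow_add, Nat.sub_add_cancel hn]
    have h3 : ∀ i, ν n₀ i ^ (Fintype.card k ^ n₀) ∈ Set.range (algebraMap k K) := by
      intro i
      apply hconst
      apply const_alg hS
      intro n
      refine ⟨ν (n₀ + n) i ^ (Fintype.card k ^ n₀), ?_⟩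
      rw [← pow_mul, ← pow_add, h2 _ (by omega)]
    choose c hc using h3
    apply hF.2
    rw [hν n₀ le_rfl]
    refine sum_mem fun i _ => ?_
    rw [← hc, ← Algebra.smul_def]
    exact Submodule.smul_mem _ _ (Submodule.subset_span ⟨i, rfl⟩)

lemma dual_family {ψ : K →ₗ[k] K} {V : Submodule k K} {C d : ℕ} (hS : Setup ψ V C d)
    (hconst : ∀ a : K, IsAlgebraic k a → a ∈ Set.range (algebraMap k K)) (r : ℕ)
    (F : Fin r → K) (hF : LinearIndependent k F) (i₀ : Fin r) :
    ∃ e N, ∀ n ≥ N, ∃ b ∈ V ^ (e + d * Fintype.card k ^ n), ∀ j,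
      (ψ ^ n) (b * F j) = if j = i₀ then 1 else 0 := by
  classical
  obtain ⟨n₁, hn₁⟩ := sep_family hS hconst r F hF
  replace hn₁ := hn₁ n₁ le_rfl
  let W : Submodule K (Fin r → K) :=
    { carrier := {w | ∃ b : K, ∀ j, w j = (ψ ^ n₁) (b * F j)}
      add_mem' := by
        rintro _ _ ⟨b, hb⟩ ⟨b', hb'⟩
        exact ⟨b + b', fun j => by simp [hb, hb', add_mul]⟩
      zero_mem' := ⟨0, by simp⟩
      smul_mem' := by
        rintro c _ ⟨b, hb⟩
        refine ⟨c ^ (Fintype.card k ^ n₁) * b, fun j => ?_⟩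
        rw [mul_assoc, psi_iter hS.hψ, ← hb]; rfl }
  have hW : W = ⊤ := by
    by_contra hne
    obtain ⟨f, hf0, hf⟩ := Submodule.exists_le_ker_of_lt_top W (lt_top_iff_ne_top.2 hne)
    let μ : Fin r → K := fun i => f (Pi.single i 1)
    have hfμ : ∀ w, f w = ∑ i, μ i * w i := by
      intro w
      conv_lhs => rw [← Finset.univ_sum_single w]
      rw [map_sum]
      refine Finset.sum_congr rfl fun i _ => ?_
      have : (Pi.single i (w i) : Fin r → K) = w i • Pi.single i (1 : K) := by
        rw [← Pi.single_smul, smul_eq_mul, mul_one]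
      rw [this, map_smul, smul_eq_mul, mul_comm]
    have hμ0 : ∑ i, μ i ^ (Fintype.card k ^ n₁) * F i ≠ 0 := by
      intro h
      have := hn₁ μ h
      apply hf0
      refine LinearMap.ext fun w => ?_
      simp [hfμ, this]
    have hz : ∀ y, (ψ ^ n₁) y = 0 := by
      intro y
      let z := ∑ i, μ i ^ (Fintype.card k ^ n₁) * F i
      have h1 : f (fun j => (ψ ^ n₁) (y / z * F j)) = 0 := hf ⟨y / z, fun j => rfl⟩
      rw [hfμ] at h1
      have h2 : y = ∑ i, μ i ^ (Fintype.card k ^ n₁) * (y / z * F i) := by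
        have : ∑ i, μ i ^ (Fintype.card k ^ n₁) * (y / z * F i) = y / z * z := by
          simp only [z]
          rw [Finset.mul_sum]
          exact Finset.sum_congr rfl fun i _ => by ring
        rw [this, div_mul_cancel₀ _ hμ0]
      rw [h2, map_sum, ← h1]
      exact Finset.sum_congr rfl fun i _ => psi_iter hS.hψ _ _ _
    obtain ⟨e, N, hN⟩ := hS.test 1 1 (by simpa using hS.one) one_ne_zero
    obtain ⟨g, -, hg⟩ := hN (N + n₁) (by omega)
    rw [pow_add, Module.End.mul_apply, hz, map_zero] at hg
    exact zero_ne_one hg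
  obtain ⟨b, hb⟩ : (Pi.single i₀ 1 : Fin r → K) ∈ W := by rw [hW]; trivial
  obtain ⟨s, hs0, i, hs, hbs⟩ := hS.frac b
  obtain ⟨e, N, hN⟩ := hS.test i s hs hs0
  refine ⟨i + i * (Fintype.card k ^ n₁ - 1) + e * Fintype.card k ^ n₁, N + n₁, fun n hn => ?_⟩
  obtain ⟨n₂, rfl⟩ : ∃ n₂, n = n₂ + n₁ := ⟨n - n₁, by omega⟩
  obtain ⟨g, hg, hsg⟩ := hN n₂ (by omega)
  refine ⟨b * s * s ^ (Fintype.card k ^ n₁ - 1) * g ^ (Fintype.card k ^ n₁), ?_, ?_⟩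
  · have := mul_mem_pow (mul_mem_pow hbs (pow_mem_pow' hs (Fintype.card k ^ n₁ - 1)))
      (pow_mem_pow' hg (Fintype.card k ^ n₁))
    convert this using 2
    rw [pow_add]; ring
  · intro j
    have hQ : 0 < Fintype.card k ^ n₁ := by have := Fintype.card_pos (α := k); positivity
    have h1 : b * s * s ^ (Fintype.card k ^ n₁ - 1) * g ^ (Fintype.card k ^ n₁) * F j =
        (s * g) ^ (Fintype.card k ^ n₁) * (b * F j) := by
      rw [mul_pow, ← mul_pow_sub_one hQ.ne' s]; ring
    rw [h1, pow_add, Module.End.mul_apply, psi_iter hS.hψ, ← hb, Pi.single_apply]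
    split_ifs
    · rw [mul_one, hsg]
    · rw [mul_zero, map_zero]

end QF

namespace QF

open Polynomial

section tr
variable {k K : Type*} [Field k] [Field K] [Algebra k K]

lemma exists_proj (W : Submodule k K) : ∃ g : K →ₗ[k] W, g ∘ₗ W.subtype = LinearMap.id :=
  W.subtype.exists_leftInverse_of_injective W.ker_subtype

/-- trace on `W` of the compression of `θ` to `W`. -/
noncomputable def trOn (W : Submodule k K) (θ : K →ₗ[k] K) : k :=
  LinearMap.trace k W ((exists_proj W).choose ∘ₗ θ ∘ₗ W.subtype)

lemma trOn_add (W : Submodule k K) (θ θ' : K →ₗ[k] K) :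
    trOn W (θ + θ') = trOn W θ + trOn W θ' := by
  unfold trOn
  rw [← map_add, ← LinearMap.comp_add, ← LinearMap.add_comp]

lemma trOn_smul (W : Submodule k K) (a : k) (θ : K →ₗ[k] K) :
    trOn W (a • θ) = a * trOn W θ := by
  unfold trOn
  rw [← smul_eq_mul, ← map_smul, ← LinearMap.comp_smul, ← LinearMap.smul_comp]

lemma trOn_eq (W : Submodule k K) (θ : K →ₗ[k] K) (τ : W →ₗ[k] W)
    (h : ∀ w : W, θ w = τ w) : trOn W θ = LinearMap.trace k W τ := by
  unfold trOn
  congr 1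
  ext w : 1
  have := LinearMap.congr_fun (exists_proj W).choose_spec (τ w)
  simp only [LinearMap.comp_apply, Submodule.subtype_apply, h] at this ⊢
  exact this

lemma trOn_comm (W W' : Submodule k K) (hW : W.FG) (hW' : W'.FG) (T M : K →ₗ[k] K)
    (hT : ∀ w ∈ W', T w ∈ W) (hM : ∀ w ∈ W, M w ∈ W') :
    trOn W (T ∘ₗ M) = trOn W' (M ∘ₗ T) := by
  have : Module.Finite k W := Module.Finite.of_fg hW
  have : Module.Finite k W' := Module.Finite.of_fg hW'
  have := LinearMap.trace_comp_comm' (M.restrict hM) (T.restrict hT)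
  rw [trOn_eq W _ (T.restrict hT ∘ₗ M.restrict hM) (fun w => rfl),
    trOn_eq W' _ (M.restrict hM ∘ₗ T.restrict hT) (fun w => rfl), this]

end tr

section graded
variable {k K : Type*} [Field k] [Field K] [Algebra k K]

/-- The graded (Rees) algebra `⊕ V ^ i X ^ i`. -/
noncomputable def Sg (V : Submodule k K) : Subalgebra k K[X] :=
  Algebra.adjoin k {p | ∃ v ∈ V, p = monomial 1 v}

lemma Sg_coeff {V : Submodule k K} {p : K[X]} (hp : p ∈ Sg V) (i : ℕ) : p.coeff i ∈ V ^ i := by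
  classical
  induction hp using Algebra.adjoin_induction generalizing i with
  | mem x hx =>
    obtain ⟨v, hv, rfl⟩ := hx
    rw [coeff_monomial]
    split_ifs with h
    · subst h; simpa using hv
    · exact zero_mem _
  | algebraMap r =>
    rw [Polynomial.algebraMap_apply, coeff_C]
    split_ifs with h
    · subst h; rw [pow_zero]; exact Submodule.mem_one.2 ⟨r, rfl⟩
    · exact zero_mem _
  | add x y _ _ hx hy => rw [coeff_add]; exact add_mem (hx i) (hy i)
  | mul x y _ _ hx hy =>
    rw [coeff_mul]
    refine sum_mem fun j hj => ?_
    rw [← Finset.HasAntidiagonal.mem_antidiagonal.1 hj]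
    exact mul_mem_pow (hx _) (hy _)

lemma monomial_mem_Sg {V : Submodule k K} {i : ℕ} {a : K} (ha : a ∈ V ^ i) :
    monomial i a ∈ Sg V := by
  induction i generalizing a with
  | zero =>
    rw [pow_zero] at ha
    obtain ⟨r, rfl⟩ := Submodule.mem_one.1 ha
    exact Subalgebra.algebraMap_mem (Sg V) r
  | succ i ih =>
    rw [pow_succ] at ha
    refine Submodule.mul_induction_on ha ?_ ?_
    · intro m hm v hv
      rw [← monomial_mul_monomial]
      exact mul_mem (ih hm) (Algebra.subset_adjoin ⟨v, hv, rfl⟩)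
    · intro x y hx hy
      rw [map_add]; exact add_mem hx hy

end graded

section main
variable {k K : Type*} [Field k] [Fintype k] [Field K] [Algebra k K]

/-- the ideal generated by `Φ s - s ^ Q` -/
noncomputable def Iq (V : Submodule k K) (f : K →ₐ[k] K) (h : K) (c n : ℕ) : Ideal (Sg V) :=
  Ideal.span {y | ∃ v ∈ V, (y : K[X]) = monomial c (h * f v) -
    monomial (Fintype.card k ^ n) (v ^ Fintype.card k ^ n)}

/-- the operator `w ↦ ψ ^ n (β h ^ l f w)` -/
noncomputable def theta (ψ : K →ₗ[k] K) (f : K →ₐ[k] K) (h : K) (n l : ℕ) (β : K) : K →ₗ[k] K :=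
  (ψ ^ n) ∘ₗ (LinearMap.mulLeft k (β * h ^ l)) ∘ₗ f.toLinearMap

lemma theta_apply (ψ : K →ₗ[k] K) (f : K →ₐ[k] K) (h : K) (n l : ℕ) (β w : K) :
    theta ψ f h n l β w = (ψ ^ n) (β * h ^ l * f w) := rfl

/-- the trace functional in level `l` -/
noncomputable def ell (ψ : K →ₗ[k] K) (V : Submodule k K) (f : K →ₐ[k] K) (h : K) (n l : ℕ) :
    K →ₗ[k] k where
  toFun β := trOn (V ^ l) (theta ψ f h n l β)
  map_add' a b := by
    rw [← trOn_add]
    congr 1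
    ext w
    simp [theta_apply, add_mul]
  map_smul' a b := by
    rw [RingHom.id_apply, smul_eq_mul, ← trOn_smul]
    congr 1
    ext w
    simp [theta_apply]

open Classical in
/-- the total trace functional -/
noncomputable def tot (ψ : K →ₗ[k] K) (V : Submodule k K) (f : K →ₐ[k] K) (h : K) (c C n : ℕ) :
    K[X] →ₗ[k] k :=
  Polynomial.lsum fun i => if hi : ∃ l, i + c * l + Fintype.card k ^ n * C =
      Fintype.card k ^ n * l then ell ψ V f h n hi.choose else 0

variable {ψ : K →ₗ[k] K} {V : Submodule k K} {f : K →ₐ[k] K} {h : K} {c C d n : ℕ}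

lemma tot_monomial (hc : c < Fintype.card k ^ n) {i l : ℕ}
    (hi : i + c * l + Fintype.card k ^ n * C = Fintype.card k ^ n * l) (a : K) :
    tot ψ V f h c C n (monomial i a) = ell ψ V f h n l a := by
  have hex : ∃ l, i + c * l + Fintype.card k ^ n * C = Fintype.card k ^ n * l := ⟨l, hi⟩
  have : hex.choose = l := by
    have h1 := hex.choose_spec
    generalize hex.choose = m at h1
    generalize Fintype.card k ^ n = Q at *
    zify at hi h1 hc
    have h2 : ((Q : ℤ) - c) * (m - l) = 0 := by linear_combination hi - h1
    rcases mul_eq_zero.1 h2 with h3 | h3 <;> omega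
  rw [tot, lsum_apply, sum_monomial_index _ _ (by simp), dif_pos hex, this]

lemma tot_monomial_zero {i : ℕ}
    (hi : ¬ ∃ l, i + c * l + Fintype.card k ^ n * C = Fintype.card k ^ n * l) (a : K) :
    tot ψ V f h c C n (monomial i a) = 0 := by
  rw [tot, lsum_apply, sum_monomial_index _ _ (by simp), dif_neg hi]; rfl

lemma h_pow_mem (hS : Setup ψ V C d) (hh : ∀ v ∈ V, h * f v ∈ V ^ c) (l : ℕ) :
    ∀ w ∈ V ^ l, h ^ l * f w ∈ V ^ (c * l) := by
  induction l with
  | zero =>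
    intro w hw
    rw [pow_zero] at hw
    obtain ⟨r, rfl⟩ := Submodule.mem_one.1 hw
    simp [Submodule.mem_one]
  | succ l ih =>
    intro w hw
    rw [pow_succ] at hw
    refine Submodule.mul_induction_on hw ?_ ?_
    · intro m hm v hv
      have := mul_mem_pow (ih m hm) (hh v hv)
      rw [mul_add, mul_one]
      convert this using 1
      rw [map_mul]; ring
    · intro x y hx hy
      rw [map_add, mul_add (h ^ (l + 1))]; exact add_mem hx hy

lemma ell_rel (hS : Setup ψ V C d) (hh : ∀ v ∈ V, h * f v ∈ V ^ c) {j l : ℕ}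
    (hj : j + c + c * l + Fintype.card k ^ n * C = Fintype.card k ^ n * l) {β v : K}
    (hβ : β ∈ V ^ j) (hv : v ∈ V) :
    ell ψ V f h n l (β * (h * f v)) =
      ell ψ V f h n (l + 1) (β * v ^ Fintype.card k ^ n) := by
  have hQ : 0 < Fintype.card k ^ n := by have := Fintype.card_pos (α := k); positivity
  change trOn _ _ = trOn _ _
  have e1 : theta ψ f h n l (β * (h * f v)) =
      (theta ψ f h n (l + 1) β) ∘ₗ (LinearMap.mulLeft k v) := by
    ext w
    simp only [theta_apply, LinearMap.comp_apply, LinearMap.mulLeft_apply, map_mul]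
    congr 1; ring
  have e2 : theta ψ f h n (l + 1) (β * v ^ Fintype.card k ^ n) =
      (LinearMap.mulLeft k v) ∘ₗ (theta ψ f h n (l + 1) β) := by
    ext w
    simp only [theta_apply, LinearMap.comp_apply, LinearMap.mulLeft_apply]
    rw [← psi_iter hS.hψ]
    congr 1; ring
  rw [e1, e2]
  apply trOn_comm _ _ (hS.fg.pow _) (hS.fg.pow _)
  · intro w hw
    rw [theta_apply, mul_assoc]
    have := hS.growth n _ _ (mul_mem_pow hβ (h_pow_mem hS hh (l + 1) w hw))
    refine pow_mono_sub hS.one ?_ this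
    have h3 : C ≤ l := by
      by_contra! hlt
      have := Nat.mul_lt_mul_of_pos_left hlt hQ
      omega
    obtain ⟨l', rfl⟩ : ∃ l', l = l' + C := ⟨l - C, by omega⟩
    rw [add_le_add_iff_right]
    apply Nat.div_le_of_le_mul
    rw [mul_add (Fintype.card k ^ n)] at hj
    rw [mul_add c _ 1]
    omega
  · intro w hw
    rw [pow_succ']
    exact Submodule.mul_mem_mul hv hw

lemma tot_kills (hS : Setup ψ V C d) (hh : ∀ v ∈ V, h * f v ∈ V ^ c)
    (hc : c < Fintype.card k ^ n) (y : Sg V) (hy : y ∈ Iq V f h c n) :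
    ∀ b : Sg V, tot ψ V f h c C n ((b * y : Sg V) : K[X]) = 0 := by
  have hQ : 0 < Fintype.card k ^ n := by have := Fintype.card_pos (α := k); positivity
  refine Submodule.span_induction (p := fun y _ => ∀ b : Sg V,
    tot ψ V f h c C n ((b * y : Sg V) : K[X]) = 0) ?_ ?_ ?_ ?_ hy
  · rintro y ⟨v, hv, hy⟩ b
    have key : ∀ j, ∀ β ∈ V ^ j, tot ψ V f h c C n (monomial j β * (y : K[X])) = 0 := by
      intro j β hβ
      rw [hy, mul_sub, monomial_mul_monomial, monomial_mul_monomial, map_sub, sub_eq_zero]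
      by_cases hl : ∃ l, j + c + c * l + Fintype.card k ^ n * C = Fintype.card k ^ n * l
      · obtain ⟨l, hl⟩ := hl
        rw [tot_monomial hc hl, ell_rel hS hh hl hβ hv, tot_monomial hc]
        rw [mul_add, mul_add]; omega
      · rw [tot_monomial_zero hl, tot_monomial_zero]
        rintro ⟨l, hl'⟩
        apply hl
        rcases l with _ | l
        · simp only [mul_zero] at hl'; omega
        · refine ⟨l, ?_⟩
          rw [mul_add, mul_add] at hl'; omega
    rw [MulMemClass.coe_mul, (b : K[X]).as_sum_range, Finset.sum_mul, map_sum]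
    exact Finset.sum_eq_zero fun i _ => key i _ (Sg_coeff b.2 i)
  · simp
  · intro x y _ _ hx hy b
    rw [mul_add, AddMemClass.coe_add, map_add, hx, hy, add_zero]
  · intro a x _ hx b
    rw [smul_eq_mul, ← mul_assoc, hx]

lemma not_mem_Iq (hS : Setup ψ V C d) (hh : ∀ v ∈ V, h * f v ∈ V ^ c) (h0 : h ≠ 0)
    (hconst : ∀ a : K, IsAlgebraic k a → a ∈ Set.range (algebraMap k K))
    {u : K} (hu : u ≠ 0) (e : ℕ) :
    ∃ N, ∀ n ≥ N, ∀ y ∈ Iq V f h c n, (y : K[X]) ≠ monomial e u := by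
  classical
  set m := C + d + 1 with hm
  have hfin : Module.Finite k (V ^ m : Submodule k K) := Module.Finite.of_fg (hS.fg.pow _)
  let B := Module.finBasis k (V ^ m : Submodule k K)
  have one : (1 : K) ∈ V ^ m := pow_mono_sub hS.one (Nat.zero_le m)
    (by rw [pow_zero]; exact Submodule.one_le.1 le_rfl)
  obtain ⟨i₀, hi₀⟩ : ∃ i₀, B.repr ⟨1, one⟩ i₀ ≠ 0 := by
    by_contra! hcon
    have : B.repr ⟨1, one⟩ = 0 := Finsupp.ext hcon
    rw [LinearEquiv.map_eq_zero_iff] at this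
    exact one_ne_zero (congrArg Subtype.val this)
  have hF : LinearIndependent k (fun i => u * h ^ m * f (B i : K)) := by
    have h1 := B.linearIndependent
    let g : (V ^ m : Submodule k K) →ₗ[k] K :=
      (LinearMap.mulLeft k (u * h ^ m)) ∘ₗ f.toLinearMap ∘ₗ (V ^ m : Submodule k K).subtype
    have h2 := h1.map' g (by
      rw [LinearMap.ker_eq_bot]
      intro a b hab
      have : u * h ^ m * f a = u * h ^ m * f b := hab
      exact Subtype.ext (f.injective (mul_left_cancel₀ (mul_ne_zero hu (pow_ne_zero _ h0)) this)))
    exact h2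
  obtain ⟨e', N, hN⟩ := dual_family hS hconst _ _ hF i₀
  refine ⟨N + (e' + c * m + e + c + 1), fun n hn y hy hyu => ?_⟩
  have hQ : n < Fintype.card k ^ n := Nat.lt_pow_self Fintype.one_lt_card
  obtain ⟨b, hb, hbF⟩ := hN n (by omega)
  obtain ⟨j, hj⟩ : ∃ j, j + e + c * m + Fintype.card k ^ n * C = Fintype.card k ^ n * m := by
    refine ⟨Fintype.card k ^ n * (d + 1) - (e + c * m), ?_⟩
    have : Fintype.card k ^ n * (d + 1) ≥ Fintype.card k ^ n := Nat.le_mul_of_pos_right _ (by omega)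
    rw [hm, show C + d + 1 = d + 1 + C by ring, mul_add (Fintype.card k ^ n) (d + 1)]
    rw [hm, show C + d + 1 = d + 1 + C by ring] at hn
    omega
  have hbj : b ∈ V ^ j := by
    refine pow_mono_sub hS.one ?_ hb
    rw [hm, show C + d + 1 = d + 1 + C by ring, mul_add (Fintype.card k ^ n) (d + 1),
      mul_add (Fintype.card k ^ n) d, mul_one] at hj
    rw [mul_comm d]
    rw [hm, show C + d + 1 = d + 1 + C by ring] at hn
    omega
  have hk := tot_kills hS hh (by omega) y hy ⟨monomial j b, monomial_mem_Sg hbj⟩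
  rw [MulMemClass.coe_mul, hyu] at hk
  simp only [monomial_mul_monomial] at hk
  rw [tot_monomial (by omega) hj] at hk
  have hτ : ell ψ V f h n m (b * u) = B.repr ⟨1, one⟩ i₀ := by
    change trOn _ _ = _
    rw [trOn_eq _ _ ((B.coord i₀).smulRight ⟨1, one⟩), LinearMap.trace_smulRight]
    · rfl
    · intro w
      have : (theta ψ f h n m (b * u)) ∘ₗ (V ^ m : Submodule k K).subtype =
          (V ^ m : Submodule k K).subtype ∘ₗ ((B.coord i₀).smulRight ⟨1, one⟩) := by
        refine B.ext fun i => ?_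
        have h1 := hbF i
        simp only [LinearMap.comp_apply, Submodule.subtype_apply, theta_apply,
          LinearMap.smulRight_apply, Module.Basis.coord_apply, Module.Basis.repr_self]
        rw [show b * u * h ^ m * f (B i : K) = b * (u * h ^ m * f (B i : K)) by ring, h1,
          Finsupp.single_apply]
        split_ifs <;> simp
      exact LinearMap.congr_fun this w
  exact hi₀ (hτ.symm.trans hk)

end main
end QF

namespace QF

section nilp
open Polynomial

lemma nilp_pow {k R : Type*} [Field k] [CommRing R] [Algebra k R] {y : R} (hy : IsNilpotent y)
    {p : k[X]} (hp : p ≠ 0) (h : aeval y p = 0) : y ^ p.natDegree = 0 := by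
  classical
  obtain ⟨N, hN⟩ := hy
  have h1 : EuclideanDomain.gcd p (X ^ N) ∣ (X : k[X]) ^ N := EuclideanDomain.gcd_dvd_right _ _
  obtain ⟨t, ht, hass⟩ := (dvd_prime_pow (Polynomial.prime_X (R := k)) N).1 h1
  have h2 : aeval y (EuclideanDomain.gcd p (X ^ N)) = 0 := by
    rw [EuclideanDomain.gcd_eq_gcd_ab]
    simp [h, hN]
  have h3 : (X : k[X]) ^ t ∣ p := hass.symm.dvd.trans (EuclideanDomain.gcd_dvd_left _ _)
  have h4 : y ^ t = 0 := by
    obtain ⟨c, hc⟩ := hass.dvd_iff_dvd_left.1 (dvd_refl _) |> fun h => hass.dvd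
    obtain ⟨c, hc⟩ := hass.dvd
    have := congrArg (aeval y) hc
    simpa [h2] using this
  have h5 : t ≤ p.natDegree := by
    have := natDegree_le_of_dvd h3 hp
    simpa using this
  exact pow_eq_zero_of_le h5 h4

lemma digits_inj {D Q : ℕ} {a b : Fin (D + 1) →₀ ℕ} (ha : ∀ i, a i < Q) (hb : ∀ i, b i < Q)
    (h : ∑ i, a i * Q ^ (i : ℕ) = ∑ i, b i * Q ^ (i : ℕ)) : a = b := by
  have h1 : finFunctionFinEquiv (fun i => (⟨a i, ha i⟩ : Fin Q)) =
      finFunctionFinEquiv (fun i => (⟨b i, hb i⟩ : Fin Q)) := by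
    apply Fin.ext
    simpa [finFunctionFinEquiv_apply] using h
  have h2 := finFunctionFinEquiv.injective h1
  ext i
  exact congrArg Fin.val (congrFun h2 i)

lemma subst_eq {k : Type*} [Field k] {D : ℕ} (P : MvPolynomial (Fin (D + 1)) k) (Q : ℕ) :
    MvPolynomial.aeval (fun i : Fin (D + 1) => (X : k[X]) ^ (Q ^ (i : ℕ))) P =
      ∑ a ∈ P.support, monomial (∑ i, a i * Q ^ (i : ℕ)) (P.coeff a) := by
  rw [MvPolynomial.aeval_def, MvPolynomial.eval₂_eq']
  refine Finset.sum_congr rfl fun a _ => ?_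
  rw [← C_mul_X_pow_eq_monomial, ← Finset.prod_pow_eq_pow_sum]
  simp only [← pow_mul, mul_comm]
  rfl

lemma subst_ne_zero {k : Type*} [Field k] {D : ℕ} {P : MvPolynomial (Fin (D + 1)) k} (hP : P ≠ 0)
    {Q : ℕ} (hQ : P.totalDegree < Q) :
    MvPolynomial.aeval (fun i : Fin (D + 1) => (X : k[X]) ^ (Q ^ (i : ℕ))) P ≠ 0 := by
  classical
  have hlt : ∀ a ∈ P.support, ∀ i, a i < Q := fun a ha i =>
    (((Finsupp.le_degree i a).trans (MvPolynomial.le_totalDegree ha))).trans_lt hQ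
  obtain ⟨a, ha⟩ := MvPolynomial.support_nonempty.2 hP
  intro h0
  have := congrArg (fun p => p.coeff (∑ i, a i * Q ^ (i : ℕ))) h0
  simp only [subst_eq, finsetSum_coeff, coeff_monomial, coeff_zero] at this
  rw [Finset.sum_eq_single a] at this
  · simp only [if_true] at this
    exact MvPolynomial.mem_support_iff.1 ha this
  · intro b hb hba
    rw [if_neg]
    exact fun h => hba (digits_inj (hlt b hb) (hlt a ha) h)
  · exact fun h => absurd ha h

lemma subst_natDegree {k : Type*} [Field k] {D : ℕ} (P : MvPolynomial (Fin (D + 1)) k) {Q : ℕ}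
    (hQ : 0 < Q) :
    (MvPolynomial.aeval (fun i : Fin (D + 1) => (X : k[X]) ^ (Q ^ (i : ℕ))) P).natDegree ≤
      P.totalDegree * Q ^ D := by
  rw [subst_eq]
  refine natDegree_sum_le_of_forall_le _ _ fun a ha => (natDegree_monomial_le _).trans ?_
  calc ∑ i, a i * Q ^ (i : ℕ) ≤ ∑ i, a i * Q ^ D := by
        refine Finset.sum_le_sum fun i _ => Nat.mul_le_mul_left _ (Nat.pow_le_pow_right hQ ?_)
        omega
    _ = (∑ i, a i) * Q ^ D := by rw [Finset.sum_mul]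
    _ ≤ _ := by
        refine Nat.mul_le_mul_right _ ?_
        refine le_trans ?_ (MvPolynomial.le_totalDegree ha)
        rw [Finsupp.sum_fintype _ _ (fun _ => rfl)]

end nilp

section Phi
open Polynomial
variable {k K : Type*} [Field k] [Fintype k] [Field K] [Algebra k K]

/-- The endomorphism of `K[X]` acting by `f` on coefficients and sending `X` to `h X^c`. -/
noncomputable def PhiK (f : K →ₐ[k] K) (h : K) (c : ℕ) : K[X] →ₐ[k] K[X] :=
  { Polynomial.eval₂RingHom ((C : K →+* K[X]).comp (f : K →+* K)) (C h * X ^ c) with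
    commutes' := fun r => by
      simp [Polynomial.algebraMap_apply] }

lemma PhiK_monomial (f : K →ₐ[k] K) (h : K) (c i : ℕ) (a : K) :
    PhiK f h c (monomial i a) = monomial (c * i) (f a * h ^ i) := by
  change Polynomial.eval₂ _ _ _ = _
  rw [eval₂_monomial, mul_pow, ← pow_mul, ← C_pow, ← mul_assoc]
  simp only [RingHom.comp_apply, ← C_mul, C_mul_X_pow_eq_monomial]
  rfl

lemma PhiK_mem {V : Submodule k K} {f : K →ₐ[k] K} {h : K} {c : ℕ}
    (hh : ∀ v ∈ V, h * f v ∈ V ^ c) (s : Sg V) : PhiK f h c s ∈ Sg V := by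
  have : Sg V ≤ (Sg V).comap (PhiK f h c) := by
    refine Algebra.adjoin_le ?_
    rintro _ ⟨v, hv, rfl⟩
    change PhiK f h c _ ∈ Sg V
    rw [PhiK_monomial, mul_one, pow_one, mul_comm]
    exact monomial_mem_Sg (hh v hv)
  exact this s.2

/-- `PhiK` restricted to `Sg V`. -/
noncomputable def Phi {V : Submodule k K} {f : K →ₐ[k] K} {h : K} {c : ℕ}
    (hh : ∀ v ∈ V, h * f v ∈ V ^ c) : Sg V →ₐ[k] Sg V :=
  ((PhiK f h c).comp (Sg V).val).codRestrict (Sg V) (fun s => PhiK_mem hh s)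

lemma Phi_val {V : Submodule k K} {f : K →ₐ[k] K} {h : K} {c : ℕ}
    (hh : ∀ v ∈ V, h * f v ∈ V ^ c) (s : Sg V) : (Phi hh s : K[X]) = PhiK f h c s := rfl

lemma quot_Phi {V : Submodule k K} {f : K →ₐ[k] K} {h : K} {c : ℕ}
    (hh : ∀ v ∈ V, h * f v ∈ V ^ c) {n : ℕ} {R : Type*} [CommRing R] [Algebra k R]
    (π : Sg V →ₐ[k] R) (hπ : ∀ y ∈ Iq V f h c n, π y = 0) (s : Sg V) :
    π (Phi hh s) = (π s) ^ (Fintype.card k ^ n) := by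
  rw [← Fr_apply (k := k)]
  obtain ⟨s, hs⟩ := s
  induction hs using Algebra.adjoin_induction with
  | mem x hx =>
    rw [Fr_apply, ← map_pow, ← sub_eq_zero, ← map_sub]
    obtain ⟨v, hv, rfl⟩ := hx
    refine hπ _ (Ideal.subset_span ⟨v, hv, ?_⟩)
    rw [AddSubgroupClass.coe_sub, Phi_val, PhiK_monomial, SubmonoidClass.coe_pow, monomial_pow]
    simp [mul_comm]
  | algebraMap r =>
    have e : (⟨algebraMap k K[X] r, (Sg V).algebraMap_mem r⟩ : Sg V) = algebraMap k (Sg V) r := rfl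
    rw [e, AlgHom.commutes, AlgHom.commutes, AlgHom.commutes]
  | add x y hx hy h1 h2 =>
    have e : (⟨x + y, (Sg V).add_mem hx hy⟩ : Sg V) = ⟨x, hx⟩ + ⟨y, hy⟩ := rfl
    rw [e, map_add, map_add, h1, h2, map_add, map_add]
  | mul x y hx hy h1 h2 =>
    have e : (⟨x * y, (Sg V).mul_mem hx hy⟩ : Sg V) = ⟨x, hx⟩ * ⟨y, hy⟩ := rfl
    rw [e, map_mul, map_mul, h1, h2, map_mul, map_mul]

lemma Sg_finiteType {V : Submodule k K} (hV : V.FG) : Algebra.FiniteType k (Sg V) := by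
  have : Module.Finite k V := Module.Finite.of_fg hV
  have : Finite V := Module.finite_of_finite k
  rw [← Subalgebra.fg_iff_finiteType]
  refine Subalgebra.fg_def.2 ⟨_, ?_, rfl⟩
  refine (Set.finite_range (fun v : V => monomial 1 (v : K))).subset ?_
  rintro _ ⟨v, hv, rfl⟩
  exact ⟨⟨v, hv⟩, rfl⟩

lemma exists_rel {k R : Type*} [Field k] [CommRing R] [Algebra k R] [Algebra.FiniteType k R]
    (Φ : R → R) (η : R) : ∃ (D : ℕ) (P : MvPolynomial (Fin (D + 1)) k), P ≠ 0 ∧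
      MvPolynomial.aeval (fun i : Fin (D + 1) => Φ^[i] η) P = 0 := by
  obtain ⟨D, hD⟩ := Cardinal.lt_aleph0.1 (_root_.trdeg_lt_aleph0_of_finiteType (R := k) (S := R))
  have : ¬ AlgebraicIndependent k (fun i : Fin (D + 1) => Φ^[i] η) := by
    intro h
    have := h.lift_cardinalMk_le_trdeg
    rw [hD] at this
    simp at this
  rw [AlgebraicIndependent, injective_iff_map_eq_zero] at this
  push Not at this
  obtain ⟨P, h1, h2⟩ := this
  exact ⟨D, P, h2, h1⟩

lemma one_Sg {V : Submodule k K} (h1 : (1 : K) ∈ V) : monomial 1 (1 : K) ∈ Sg V :=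
  Algebra.subset_adjoin ⟨1, h1, rfl⟩

lemma Phi_iter_mono {V : Submodule k K} {f : K →ₐ[k] K} {h : K} {c : ℕ}
    (hh : ∀ v ∈ V, h * f v ∈ V ^ c) (h0 : h ≠ 0) (h1 : (1 : K) ∈ V) (D : ℕ) :
    ∃ e u, u ≠ 0 ∧ (((Phi hh)^[D] ⟨monomial 1 (1 : K), one_Sg h1⟩ : Sg V) : K[X]) =
      monomial e u := by
  induction D with
  | zero => exact ⟨1, 1, one_ne_zero, rfl⟩
  | succ D ih =>
    obtain ⟨e, u, hu, he⟩ := ih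
    rw [Function.iterate_succ_apply', Phi_val, he, PhiK_monomial]
    refine ⟨_, _, mul_ne_zero ?_ (pow_ne_zero _ h0), rfl⟩
    simpa using hu

lemma quot_Phi_iter {V : Submodule k K} {f : K →ₐ[k] K} {h : K} {c : ℕ}
    (hh : ∀ v ∈ V, h * f v ∈ V ^ c) {n : ℕ} {R : Type*} [CommRing R] [Algebra k R]
    (π : Sg V →ₐ[k] R) (hπ : ∀ y ∈ Iq V f h c n, π y = 0) (s : Sg V) (i : ℕ) :
    π ((Phi hh)^[i] s) = (π s) ^ ((Fintype.card k ^ n) ^ i) := by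
  induction i with
  | zero => simp
  | succ i ih =>
    rw [Function.iterate_succ_apply', quot_Phi hh π hπ, ih, ← pow_mul, pow_succ]

lemma not_nilp {ψ : K →ₗ[k] K} {V : Submodule k K} {C d : ℕ} (hS : Setup ψ V C d)
    {f : K →ₐ[k] K} {h : K} {c : ℕ} (hh : ∀ v ∈ V, h * f v ∈ V ^ c) (h0 : h ≠ 0)
    (hconst : ∀ a : K, IsAlgebraic k a → a ∈ Set.range (algebraMap k K)) :
    ∃ n, ∀ {R : Type _} [CommRing R] [Algebra k R]
    (π : Sg V →ₐ[k] R) (_ : ∀ y, y ∈ Iq V f h c n ↔ π y = 0),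
      ¬ IsNilpotent (π ⟨monomial 1 (1 : K), one_Sg hS.one⟩) := by
  have := Sg_finiteType hS.fg
  obtain ⟨D, P, hP, hrel⟩ := exists_rel (k := k) (Phi hh) ⟨monomial 1 (1 : K), one_Sg hS.one⟩
  obtain ⟨e, u, hu, he⟩ := Phi_iter_mono hh h0 hS.one D
  obtain ⟨N, hN⟩ := not_mem_Iq (f := f) hS hh h0 hconst (pow_ne_zero P.totalDegree hu)
    (e * P.totalDegree)
  set n := max N P.totalDegree with hn
  refine ⟨n, fun π hπ hnil => ?_⟩
  have hQ : P.totalDegree < Fintype.card k ^ n :=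
    (le_max_right N _).trans_lt (Nat.lt_pow_self Fintype.one_lt_card)
  have hπ' := fun y hy => (hπ y).1 hy
  refine hN n (le_max_left _ _)
    (((Phi hh)^[D] ⟨monomial 1 (1 : K), one_Sg hS.one⟩) ^ P.totalDegree) ?_ ?_
  · rw [hπ, map_pow, quot_Phi_iter hh π hπ', ← pow_mul, mul_comm]
    refine pow_eq_zero_of_le (subst_natDegree P (by omega))
      (nilp_pow hnil (subst_ne_zero hP hQ) ?_)
    rw [← AlgHom.comp_apply, MvPolynomial.comp_aeval]
    have := congrArg π hrel
    rw [← AlgHom.comp_apply, MvPolynomial.comp_aeval, map_zero] at this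
    convert this using 3
    ext i
    simp only [map_pow, aeval_X]
    exact (quot_Phi_iter hh π hπ' _ _).symm
  · rw [SubmonoidClass.coe_pow, he, monomial_pow]

lemma null {k R L : Type*} [Field k] [CommRing R] [Algebra k R] [Algebra.FiniteType k R]
    [Field L] [IsAlgClosed L] [Algebra k L] {η : R} (h : ¬ IsNilpotent η) :
    ∃ y : R →ₐ[k] L, y η ≠ 0 := by
  have hnt : Nontrivial (Localization.Away η) := by
    refine OreLocalization.nontrivial_iff.mpr ?_
    rintro ⟨n, hn⟩
    exact h ⟨n, hn⟩
  have : Algebra.FinitePresentation R (Localization.Away η) :=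
    IsLocalization.Away.finitePresentation η
  have : Algebra.FiniteType k (Localization.Away η) := Algebra.FiniteType.trans (S := R) inferInstance inferInstance
  obtain ⟨m, hm⟩ := Ideal.exists_maximal (Localization.Away η)
  let _ : Field (Localization.Away η ⧸ m) := Ideal.Quotient.field m
  have : Module.Finite k (Localization.Away η ⧸ m) := finite_of_finite_type_of_isJacobsonRing k _
  have : Algebra.IsAlgebraic k (Localization.Away η ⧸ m) := Algebra.IsAlgebraic.of_finite _ _
  let z : (Localization.Away η ⧸ m) →ₐ[k] L := IsAlgClosed.lift
  refine ⟨z.comp ((Ideal.Quotient.mkₐ k m).comp (IsScalarTower.toAlgHom k R _)), ?_⟩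
  have h1 : IsUnit (algebraMap R (Localization.Away η) η) := IsLocalization.Away.algebraMap_isUnit η
  exact ((h1.map (Ideal.Quotient.mkₐ k m)).map z).ne_zero

end Phi
end QF

namespace QF

section core
open Polynomial
variable {k K : Type*} [Field k] [Fintype k] [Field K] [Algebra k K]

lemma dehom {V : Submodule k K} (h1 : (1 : K) ∈ V) {L : Type*} [Field L] [Algebra k L]
    (y : Sg V →ₐ[k] L) (hy : y ⟨monomial 1 (1 : K), one_Sg h1⟩ ≠ 0) :
    ∃ x : Algebra.adjoin k (V : Set K) →ₐ[k] L, ∀ i a (ha : a ∈ V ^ i),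
      x ⟨a, pow_le_adjoin i ha⟩ * y ⟨monomial 1 (1 : K), one_Sg h1⟩ ^ i =
        y ⟨monomial i a, monomial_mem_Sg ha⟩ := by
  set η : Sg V := ⟨monomial 1 (1 : K), one_Sg h1⟩ with hη
  choose I hI using fun a : Algebra.adjoin k (V : Set K) => mem_adjoin_pow h1 a.2
  let g : Algebra.adjoin k (V : Set K) → L := fun a =>
    y ⟨monomial (I a) a, monomial_mem_Sg (hI a)⟩ / y η ^ (I a)
  have hg : ∀ i a (ha : a ∈ V ^ i), g ⟨a, pow_le_adjoin i ha⟩ * y η ^ i =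
      y ⟨monomial i a, monomial_mem_Sg ha⟩ := by
    intro i a ha
    have hp : y η ^ I ⟨a, pow_le_adjoin i ha⟩ ≠ 0 := pow_ne_zero _ hy
    change _ / _ * _ = _
    rw [div_mul_eq_mul_div, div_eq_iff hp, ← map_pow, ← map_pow, ← map_mul, ← map_mul]
    congr 1
    apply Subtype.ext
    simp only [MulMemClass.coe_mul, SubmonoidClass.coe_pow, hη, monomial_pow, one_pow,
      monomial_mul_monomial, mul_one, one_mul, add_comm]
  have key : ∀ (a : Algebra.adjoin k (V : Set K)) i (ha : (a : K) ∈ V ^ i) (z : L),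
      y ⟨monomial i (a : K), monomial_mem_Sg ha⟩ = z * y η ^ i → g a = z := by
    intro a i ha z hz
    rw [← hg i a ha] at hz
    exact mul_right_cancel₀ (pow_ne_zero _ hy) hz
  have halg : ∀ r : k, g (algebraMap k _ r) = algebraMap k L r := by
    intro r
    have hr : ((algebraMap k (Algebra.adjoin k (V : Set K)) r : Algebra.adjoin k (V : Set K)) : K)
        ∈ V ^ 0 := by
      rw [pow_zero]
      exact Submodule.algebraMap_mem r
    refine key _ 0 hr _ ?_
    refine Eq.trans ?_ (show algebraMap k L r = algebraMap k L r * y η ^ 0 by simp)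
    rw [← y.commutes]
    rfl
  refine ⟨
    { toFun := g
      map_one' := by rw [← map_one (algebraMap k _), halg, map_one]
      map_zero' := by rw [← map_zero (algebraMap k _), halg, map_zero]
      map_add' := ?_
      map_mul' := ?_
      commutes' := halg }, hg⟩
  · intro a b
    have ha := hI a
    have hb := hI b
    have ea := hg _ a ha
    have eb := hg _ b hb
    refine key _ (I a + I b) (by rw [pow_add]; exact Submodule.mul_mem_mul ha hb) _ ?_
    have e : g a * g b * y η ^ (I a + I b) = (g a * y η ^ I a) * (g b * y η ^ I b) := by ring
    refine Eq.trans ?_ ((congrArg₂ (· * ·) ea.symm eb.symm).trans e.symm)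
    rw [← map_mul]
    congr 1
    apply Subtype.ext
    simp [monomial_mul_monomial]
  · intro a b
    have ha := pow_mono_sub h1 (Nat.le_add_right (I a) (I b)) (hI a)
    have hb := pow_mono_sub h1 (Nat.le_add_left (I b) (I a)) (hI b)
    have ea := hg _ a ha
    have eb := hg _ b hb
    refine key _ (I a + I b) (add_mem ha hb) _ ?_
    rw [add_mul]
    refine Eq.trans ?_ (congrArg₂ (· + ·) ea.symm eb.symm)
    rw [← map_add]
    congr 1
    apply Subtype.ext
    simp

lemma exists_h {ψ : K →ₗ[k] K} {V : Submodule k K} {C d : ℕ} (hS : Setup ψ V C d)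
    (f : K →ₐ[k] K) : ∃ h ≠ 0, ∃ c, ∀ v ∈ V, h * f v ∈ V ^ c := by
  classical
  have : Module.Finite k V := Module.Finite.of_fg hS.fg
  have : Finite V := Module.finite_of_finite k
  cases nonempty_fintype V
  choose s hs0 i hs hs1 using fun v : V => hS.frac (f v)
  refine ⟨∏ v, s v, Finset.prod_ne_zero_iff.2 fun v _ => hs0 v, ∑ v, i v, fun v hv => ?_⟩
  rw [← Finset.mul_prod_erase Finset.univ s (Finset.mem_univ ⟨v, hv⟩),
    ← Finset.add_sum_erase Finset.univ i (Finset.mem_univ ⟨v, hv⟩), mul_right_comm, pow_add,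
    mul_comm (s _)]
  refine Submodule.mul_mem_mul (hs1 ⟨v, hv⟩) ?_
  generalize Finset.univ.erase (⟨v, hv⟩ : V) = T
  induction T using Finset.induction_on with
  | empty => simp
  | insert a T ha ih =>
    rw [Finset.prod_insert ha, Finset.sum_insert ha, pow_add]
    exact Submodule.mul_mem_mul (hs a) ih

theorem core [Algebra.EssFiniteType k K]
    (hconst : ∀ a : K, IsAlgebraic k a → a ∈ Set.range (algebraMap k K))
    (f : K →ₐ[k] K) (S : Finset K) (L : Type*) [Field L] [IsAlgClosed L] [Algebra k L] :
    ∃ n, ∃ x : Algebra.adjoin k (S : Set K) →ₐ[k] L, ∀ a (ha : a ∈ S)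
      (hfa : f a ∈ Algebra.adjoin k (S : Set K)),
      x ⟨f a, hfa⟩ = x ⟨a, Algebra.subset_adjoin ha⟩ ^ (Fintype.card k ^ n) := by
  obtain ⟨ψ, V, C, d, hS, hSV⟩ := exists_setup (k := k) S
  obtain ⟨h, h0, c, hh⟩ := exists_h hS f
  obtain ⟨n, hn⟩ := not_nilp hS hh h0 hconst
  have hmk : ∀ s, s ∈ Iq V f h c n ↔ Ideal.Quotient.mkₐ k (Iq V f h c n) s = 0 :=
    fun s => (Ideal.Quotient.eq_zero_iff_mem (I := Iq V f h c n)).symm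
  have hn := hn (R := Sg V ⧸ Iq V f h c n) (Ideal.Quotient.mkₐ k (Iq V f h c n)) hmk
  have := Sg_finiteType hS.fg
  have : Algebra.FiniteType k (Sg V ⧸ Iq V f h c n) :=
    Algebra.FiniteType.of_surjective (Ideal.Quotient.mkₐ k (Iq V f h c n))
      (Ideal.Quotient.mkₐ_surjective k _)
  obtain ⟨y', hy'⟩ := null (k := k) (L := L) hn
  let y : Sg V →ₐ[k] L := y'.comp (Ideal.Quotient.mkₐ k (Iq V f h c n))
  have hy : y ⟨monomial 1 (1 : K), one_Sg hS.one⟩ ≠ 0 := hy'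
  have hy0 : ∀ s ∈ Iq V f h c n, y s = 0 := by
    intro s hs
    exact (congrArg y' ((hmk s).1 hs)).trans (map_zero y')
  have hyΦ := quot_Phi hh y hy0
  obtain ⟨x, hx⟩ := dehom hS.one y hy
  have hhc : h ∈ V ^ c := by simpa using hh 1 hS.one
  have e1 : ∀ v (hv : v ∈ V), x ⟨h * f v, pow_le_adjoin c (hh v hv)⟩ *
      y ⟨monomial 1 (1 : K), one_Sg hS.one⟩ ^ c =
      (x ⟨v, Algebra.subset_adjoin hv⟩ * y ⟨monomial 1 (1 : K), one_Sg hS.one⟩) ^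
        (Fintype.card k ^ n) := by
    intro v hv
    have hv1 : v ∈ V ^ 1 := by rwa [pow_one]
    have := hx 1 v hv1
    rw [pow_one] at this
    rw [hx c _ (hh v hv), this, ← hyΦ]
    congr 1
    apply Subtype.ext
    rw [Phi_val, PhiK_monomial]
    simp [mul_comm]
  have e2 : x ⟨h, pow_le_adjoin c hhc⟩ * y ⟨monomial 1 (1 : K), one_Sg hS.one⟩ ^ c =
      y ⟨monomial 1 (1 : K), one_Sg hS.one⟩ ^ (Fintype.card k ^ n) := by
    have := e1 1 hS.one
    rw [show (⟨1, Algebra.subset_adjoin hS.one⟩ : Algebra.adjoin k (V : Set K)) = 1 from rfl,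
      map_one x, one_mul] at this
    rw [← this]
    congr 2
    apply Subtype.ext
    simp
  have hle : Algebra.adjoin k (S : Set K) ≤ Algebra.adjoin k (V : Set K) :=
    Algebra.adjoin_mono hSV
  refine ⟨n, x.comp (Subalgebra.inclusion hle), fun a ha hfa => ?_⟩
  change x ⟨f a, hle hfa⟩ = x ⟨a, Algebra.subset_adjoin (hSV ha)⟩ ^ _
  have e3 := e1 a (hSV ha)
  rw [show (⟨h * f a, pow_le_adjoin c (hh a (hSV ha))⟩ : Algebra.adjoin k (V : Set K)) =
    ⟨h, pow_le_adjoin c hhc⟩ * ⟨f a, hle hfa⟩ from rfl, map_mul, mul_right_comm, e2, mul_pow,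
    mul_comm] at e3
  exact mul_right_cancel₀ (pow_ne_zero _ hy) e3

end core
end QF

namespace QF

lemma mem_range_of_pow_card {k F : Type*} [Field k] [Fintype k] [Field F] [Algebra k F] {a : F}
    (h : a ^ Fintype.card k = a) : a ∈ Set.range (algebraMap k F) := by
  classical
  have h0 := FiniteField.X_pow_card_sub_X_ne_zero F (Fintype.one_lt_card (α := k))
  have hsub : (Finset.univ.image (algebraMap k F)) ⊆
      (Polynomial.X ^ Fintype.card k - Polynomial.X : Polynomial F).roots.toFinset := by
    intro y hy
    obtain ⟨b, -, rfl⟩ := Finset.mem_image.1 hy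
    rw [Multiset.mem_toFinset, Polynomial.mem_roots h0]
    simp [Polynomial.IsRoot, ← map_pow, FiniteField.pow_card]
  have hcard : (Polynomial.X ^ Fintype.card k - Polynomial.X : Polynomial F).roots.toFinset.card ≤
      (Finset.univ.image (algebraMap k F)).card := by
    rw [Finset.card_image_of_injective _ (algebraMap k F).injective, Finset.card_univ]
    refine (Multiset.toFinset_card_le _).trans ((Polynomial.card_roots' _).trans ?_)
    rw [FiniteField.X_pow_card_sub_X_natDegree_eq F Fintype.one_lt_card]
  have heq := Finset.eq_of_subset_of_card_le hsub hcard
  have ha : a ∈ (Polynomial.X ^ Fintype.card k - Polynomial.X : Polynomial F).roots.toFinset := by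
    rw [Multiset.mem_toFinset, Polynomial.mem_roots h0]
    simp [Polynomial.IsRoot, h]
  rw [← heq] at ha
  obtain ⟨b, -, rfl⟩ := Finset.mem_image.1 ha
  exact ⟨b, rfl⟩

lemma mem_range_of_isAlg {F E : Type*} [Field F] [IsAlgClosed F] [Field E] [Algebra F E] {a : E}
    (h : IsAlgebraic F a) : a ∈ Set.range (algebraMap F E) := by
  have : Algebra.IsAlgebraic F (IntermediateField.adjoin F {a}) :=
    IntermediateField.isAlgebraic_adjoin (fun x hx => by
      rw [Set.mem_singleton_iff.1 hx]; exact h.isIntegral)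
  have h2 := IntermediateField.eq_bot_of_isAlgClosed_of_isAlgebraic (IntermediateField.adjoin F {a})
  have h3 := IntermediateField.mem_adjoin_simple_self F a
  rw [h2, IntermediateField.mem_bot] at h3
  exact h3

lemma fieldcore {k F E : Type*} [Field k] [Fintype k] [Field F] [IsAlgClosed F] [Algebra k F]
    [Field E] [Algebra F E] [Algebra k E] [IsScalarTower k F E] (T : Finset E) (σ : E →+* E)
    (hσT : ∀ t ∈ T, σ t = t)
    (hσF : ∀ l : F, σ (algebraMap F E l) = algebraMap F E (l ^ Fintype.card k))
    (f : E →ₐ[F] E) (hf : ∀ t ∈ T, f t ∈ IntermediateField.adjoin k (T : Set E))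
    (S : Finset E) (hS : ∀ s ∈ S, s ∈ IntermediateField.adjoin k (T : Set E)) :
    ∃ n, ∃ x : Algebra.adjoin k (S : Set E) →ₐ[k] F, ∀ a (ha : a ∈ S)
      (hfa : f a ∈ Algebra.adjoin k (S : Set E)),
      x ⟨f a, hfa⟩ = x ⟨a, Algebra.subset_adjoin ha⟩ ^ (Fintype.card k ^ n) := by
  classical
  set K := IntermediateField.adjoin k (T : Set E) with hK
  have hess : Algebra.EssFiniteType k K :=
    IntermediateField.essFiniteType_iff.2 (IntermediateField.fg_adjoin_finset T)
  -- `σ` fixes `K`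
  have hσk : ∀ r : k, σ (algebraMap k E r) = algebraMap k E r := by
    intro r
    rw [IsScalarTower.algebraMap_apply k F E, hσF, ← map_pow, FiniteField.pow_card]
  let σk : E →ₐ[k] E := { σ with commutes' := hσk }
  have hσK : σk.comp K.val = K.val := by
    refine IntermediateField.adjoin_algHom_ext k fun x hx => ?_
    exact hσT x hx
  have hconst : ∀ a : K, IsAlgebraic k a → a ∈ Set.range (algebraMap k K) := by
    intro a ha
    have h1 : IsAlgebraic k (a : E) := ha.algHom K.val
    obtain ⟨l, hl⟩ := mem_range_of_isAlg (F := F) (h1.extendScalars (algebraMap k F).injective)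
    have h2 : σ (a : E) = a := DFunLike.congr_fun hσK a
    rw [← hl, hσF] at h2
    obtain ⟨r, hr⟩ := mem_range_of_pow_card (k := k) ((algebraMap F E).injective h2)
    refine ⟨r, Subtype.ext ?_⟩
    change algebraMap k E r = a
    rw [← hl, ← hr, ← IsScalarTower.algebraMap_apply]
  have hfK : K ≤ K.comap (f.restrictScalars k) := by
    rw [hK, IntermediateField.adjoin_le_iff]
    exact hf
  let fK : K →ₐ[k] K :=
    ((f.restrictScalars k).comp K.val).codRestrict K.toSubalgebra (fun a => hfK a.2)
  let S' : Finset K := S.attach.image (fun s => ⟨s.1, hS _ s.2⟩)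
  have hmem : ∀ a (ha : a ∈ S), (⟨a, hS a ha⟩ : K) ∈ S' := fun a ha =>
    Finset.mem_image.2 ⟨⟨a, ha⟩, Finset.mem_attach _ _, rfl⟩
  have himg : (K.val : K → E) '' (S' : Set K) = (S : Set E) := by
    ext e
    constructor
    · rintro ⟨a, ha, rfl⟩
      obtain ⟨s, -, rfl⟩ := Finset.mem_image.1 ha
      exact s.2
    · intro he
      exact ⟨⟨e, hS e he⟩, hmem e he, rfl⟩
  have hadj : (Algebra.adjoin k (S' : Set K)).map K.val = Algebra.adjoin k (S : Set E) := by
    rw [AlgHom.map_adjoin, himg]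
  have hlift : ∀ a ∈ Algebra.adjoin k (S : Set E), ∃ h : a ∈ K,
      (⟨a, h⟩ : K) ∈ Algebra.adjoin k (S' : Set K) := by
    intro a ha
    rw [← hadj] at ha
    obtain ⟨b, hb, rfl⟩ := ha
    exact ⟨b.2, hb⟩
  obtain ⟨n, x, hx⟩ := core (k := k) hconst fK S' F
  let ι : Algebra.adjoin k (S : Set E) →ₐ[k] Algebra.adjoin k (S' : Set K) :=
    { toFun := fun a => ⟨⟨a, (hlift a a.2).1⟩, (hlift a a.2).2⟩
      map_one' := rfl
      map_zero' := rfl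
      map_add' := fun _ _ => rfl
      map_mul' := fun _ _ => rfl
      commutes' := fun _ => rfl }
  refine ⟨n, x.comp ι, fun a ha hfa => ?_⟩
  exact hx ⟨a, hS a ha⟩ (hmem a ha) (hlift _ hfa).2

end QF

namespace QF

lemma exists_generic_field.{v} {A : Type v} [CommRing A] (hN : (nilradical A).IsPrime) :
    ∃ (E : Type v) (_ : Field E) (θ : A →+* E), (∀ a, θ a = 0 ↔ IsNilpotent a) ∧
      ∀ s : A →+* E, (∀ a, s a = 0 → IsNilpotent a) → ∃ s' : E →+* E, ∀ a, s' (θ a) = s a := by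
  refine ⟨FractionRing (A ⧸ nilradical A), inferInstance,
    (algebraMap (A ⧸ nilradical A) _).comp (Ideal.Quotient.mk _), ?_, ?_⟩
  · intro a
    rw [RingHom.comp_apply, IsFractionRing.to_map_eq_zero_iff, Ideal.Quotient.eq_zero_iff_mem,
      mem_nilradical]
  · intro s hs
    let s₁ : A ⧸ nilradical A →+* FractionRing (A ⧸ nilradical A) :=
      Ideal.Quotient.lift _ s (fun a ha => ((mem_nilradical.1 ha).map s).eq_zero)
    have hinj : Function.Injective s₁ := by
      rw [injective_iff_map_eq_zero]
      intro a ha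
      obtain ⟨a, rfl⟩ := Ideal.Quotient.mk_surjective a
      rw [Ideal.Quotient.eq_zero_iff_mem, mem_nilradical]
      exact hs a (by simpa [s₁] using ha)
    refine ⟨IsFractionRing.lift hinj, fun a => ?_⟩
    rw [RingHom.comp_apply, IsFractionRing.lift_algebraMap]
    simp [s₁]

lemma exists_finite_field {Fq F A₀ A : Type*} [Field Fq] [Field F] [Algebra Fq F]
    [Algebra.IsAlgebraic Fq F] [CommRing A₀] [CommRing A] (i₀ : A₀ →+* A) (iF : F →+* A)
    (hrep : ∀ a : A, ∃ (n : ℕ) (c : Fin n → A₀) (l : Fin n → F), a = ∑ j, i₀ (c j) * iF (l j))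
    (W : Finset A) : ∃ k : IntermediateField Fq F, FiniteDimensional Fq k ∧
      ∀ w ∈ W, ∃ (n : ℕ) (c : Fin n → A₀) (l : Fin n → k), w = ∑ j, i₀ (c j) * iF (l j) := by
  choose n c l h using hrep
  let Z : Set F := ⋃ w ∈ W, Set.range (l w)
  have hZ : Z.Finite := W.finite_toSet.biUnion fun w _ => Set.finite_range _
  have := hZ.to_subtype
  refine ⟨IntermediateField.adjoin Fq Z, IntermediateField.finiteDimensional_adjoin
    (fun x _ => Algebra.IsIntegral.isIntegral x), fun w hw => ⟨n w, c w, fun j => ⟨l w j, ?_⟩, h w⟩⟩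
  exact IntermediateField.subset_adjoin _ _ (Set.mem_biUnion hw ⟨j, rfl⟩)

theorem ringcore {Fq F A₀ A B : Type*} [Field Fq] [Fintype Fq] [Field F] [Algebra Fq F]
    [IsAlgClosure Fq F] [CommRing A₀] [Algebra Fq A₀] [Algebra.FiniteType Fq A₀] [CommRing A]
    (i₀ : A₀ →+* A) (iF : F →+* A)
    (hi : ∀ r, i₀ (algebraMap Fq A₀ r) = iF (algebraMap Fq F r))
    (hrep : ∀ a : A, ∃ (n : ℕ) (c : Fin n → A₀) (l : Fin n → F), a = ∑ j, i₀ (c j) * iF (l j))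
    (htwist : ∀ τ : F ≃ₐ[Fq] F, ∃ s : A →+* A, Function.Injective s ∧ (∀ a, s (i₀ a) = i₀ a) ∧
      ∀ l, s (iF l) = iF (τ l))
    (huniv : ∀ x₀ : A₀ →ₐ[Fq] F, ∃ x : A →+* F, (∀ a, x (i₀ a) = x₀ a) ∧ ∀ l, x (iF l) = l)
    (hN : (nilradical A).IsPrime) (g : A) (hg : ¬ IsNilpotent g) [CommRing B] [Algebra A B]
    [IsLocalization.Away g B] (φ : A →+* B) (hφF : ∀ l, φ (iF l) = algebraMap A B (iF l))
    (hφ : ∀ a, IsNilpotent (φ a) → IsNilpotent a) :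
    ∃ (N : ℕ) (x : B →+* F), (∀ l, x (algebraMap A B (iF l)) = l) ∧
      ∀ a, x (φ (i₀ a)) = x (algebraMap A B (i₀ a)) ^ (Fintype.card Fq ^ N) := by
  classical
  have hclosed : IsAlgClosed F := IsAlgClosure.isAlgClosed Fq
  have halg : Algebra.IsAlgebraic Fq F := IsAlgClosure.isAlgebraic
  obtain ⟨E, _, θ, hθ, hext⟩ := exists_generic_field hN
  have hθg : θ g ≠ 0 := fun h => hg ((hθ g).1 h)
  let θB : B →+* E := IsLocalization.Away.lift g (g := θ) (isUnit_iff_ne_zero.2 hθg)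
  have hθB : ∀ a, θB (algebraMap A B a) = θ a := fun a => IsLocalization.Away.lift_eq g _ a
  have hsurj : ∀ b : B, ∃ (t : ℕ) (a : A), b * algebraMap A B g ^ t = algebraMap A B a := fun b =>
    IsLocalization.Away.surj g b
  have hgu : IsUnit (algebraMap A B g) := IsLocalization.Away.algebraMap_isUnit g
  have hθBn : ∀ b, θB b = 0 → IsNilpotent b := by
    intro b hb
    obtain ⟨t, a, hta⟩ := hsurj b
    have h1 : θ a = 0 := by rw [← hθB, ← hta, map_mul, hb, zero_mul]
    have h2 : IsNilpotent (algebraMap A B a) := ((hθ a).1 h1).map _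
    rw [← hta] at h2
    obtain ⟨m, hm⟩ := h2
    rw [mul_pow] at hm
    exact ⟨m, ((hgu.pow t).pow m).mul_left_eq_zero.1 hm⟩
  obtain ⟨f₀, hf₀⟩ := hext (θB.comp φ) (fun a ha => hφ a (hθBn _ ha))
  obtain ⟨T₀, hT₀⟩ := Algebra.FiniteType.out (R := Fq) (A := A₀)
  choose t b htb using fun a : A₀ => hsurj (φ (i₀ a))
  obtain ⟨k, _, hk⟩ := exists_finite_field (Fq := Fq) i₀ iF hrep (insert g (T₀.image b))
  have : Finite k := Module.finite_of_finite Fq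
  let _ : Fintype k := Fintype.ofFinite k
  let _ : Algebra F E := (θ.comp iF).toAlgebra
  have hFE : ∀ l, algebraMap F E l = θ (iF l) := fun _ => rfl
  have hkE : ∀ l : k, algebraMap k E l = θ (iF l) := fun _ => rfl
  let f : E →ₐ[F] E := { f₀ with
    commutes' := fun l => by
      change f₀ (θ (iF l)) = θ (iF l)
      rw [hf₀, RingHom.comp_apply, hφF, hθB] }
  have hf : ∀ a, f (θ a) = θB (φ a) := hf₀
  obtain ⟨s, hs, hs0, hsF⟩ := htwist
    ((FiniteField.frobeniusAlgEquivOfAlgebraic k F).restrictScalars Fq)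
  obtain ⟨σ, hσ⟩ := hext (θ.comp s) (fun a ha => by
    obtain ⟨m, hm⟩ := (hθ _).1 ha
    refine ⟨m, hs ?_⟩
    rw [map_pow, hm, map_zero])
  let T : Finset E := T₀.image (fun a => θ (i₀ a))
  let S : Finset E := T ∪ {θ g, (θ g)⁻¹} ∪ T.image f
  have hTS : (T : Set E) ⊆ S := by
    intro e he
    simp only [S, Finset.coe_union]
    exact Or.inl (Or.inl he)
  have hθi₀ : ∀ a, θ (i₀ a) ∈ Algebra.adjoin k (T : Set E) := by
    intro a
    have ha : a ∈ Algebra.adjoin Fq (T₀ : Set A₀) := hT₀ ▸ Algebra.mem_top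
    induction ha using Algebra.adjoin_induction with
    | mem x hx => exact Algebra.subset_adjoin (Finset.mem_image_of_mem _ hx)
    | algebraMap r =>
      have e : θ (i₀ (algebraMap Fq A₀ r)) = algebraMap k E (algebraMap Fq k r) := by
        rw [hi, hkE]; rfl
      rw [e]
      exact Subalgebra.algebraMap_mem _ _
    | add x y _ _ h1 h2 => rw [map_add, map_add]; exact add_mem h1 h2
    | mul x y _ _ h1 h2 => rw [map_mul, map_mul]; exact mul_mem h1 h2
  have hθW : ∀ w ∈ insert g (T₀.image b), θ w ∈ Algebra.adjoin k (T : Set E) := by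
    intro w hw
    obtain ⟨n, c, l, rfl⟩ := hk w hw
    rw [map_sum]
    refine sum_mem fun j _ => ?_
    rw [map_mul]
    exact mul_mem (hθi₀ _) (Subalgebra.algebraMap_mem _ (l j))
  have hle : Algebra.adjoin k (T : Set E) ≤ (IntermediateField.adjoin k (T : Set E)).toSubalgebra :=
    IntermediateField.algebra_adjoin_le_adjoin k _
  have hgW : g ∈ insert g (T₀.image b) := Finset.mem_insert_self _ _
  have hbW : ∀ a ∈ T₀, b a ∈ insert g (T₀.image b) := fun a ha =>
    Finset.mem_insert_of_mem (Finset.mem_image_of_mem _ ha)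
  have hfb : ∀ a, f (θ (i₀ a)) * θ g ^ t a = θ (b a) := by
    intro a
    rw [hf, ← hθB, ← hθB, ← htb, map_mul, map_pow]
  have hfT : ∀ e ∈ T, f e ∈ IntermediateField.adjoin k (T : Set E) := by
    intro e he
    obtain ⟨a, ha, rfl⟩ := Finset.mem_image.1 he
    rw [eq_div_of_mul_eq (pow_ne_zero _ hθg) (hfb a)]
    exact div_mem (hle (hθW _ (hbW a ha))) (pow_mem (hle (hθW _ hgW)) _)
  obtain ⟨n, x, hx⟩ := fieldcore (k := k) T σ
    (by
      intro e he
      obtain ⟨a, ha, rfl⟩ := Finset.mem_image.1 he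
      rw [hσ, RingHom.comp_apply, hs0])
    (by
      intro l
      rw [hFE, hFE, hσ, RingHom.comp_apply, hsF]
      rfl) f hfT S
    (by
      intro e he
      simp only [S, Finset.mem_union, Finset.mem_insert, Finset.mem_singleton] at he
      rcases he with (he | rfl | rfl) | he
      · exact hle (Algebra.subset_adjoin he)
      · exact hle (hθW _ hgW)
      · exact inv_mem (hle (hθW _ hgW))
      · obtain ⟨e', he', rfl⟩ := Finset.mem_image.1 he
        exact hfT _ he')
  have hTS' : Algebra.adjoin k (T : Set E) ≤ Algebra.adjoin k (S : Set E) :=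
    Algebra.adjoin_mono hTS
  let x₀ : A₀ →ₐ[Fq] F :=
    { toFun := fun a => x ⟨θ (i₀ a), hTS' (hθi₀ a)⟩
      map_one' := by
        rw [← map_one x]; congr 1; exact Subtype.ext (by simp)
      map_zero' := by
        rw [← map_zero x]; congr 1; exact Subtype.ext (by simp)
      map_add' := fun a a' => by
        rw [← map_add x]; congr 1; exact Subtype.ext (by simp)
      map_mul' := fun a a' => by
        rw [← map_mul x]; congr 1; exact Subtype.ext (by simp)
      commutes' := fun r => by
        have e : (⟨θ (i₀ (algebraMap Fq A₀ r)), hTS' (hθi₀ _)⟩ : Algebra.adjoin k (S : Set E)) =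
            algebraMap k _ (algebraMap Fq k r) := by
          apply Subtype.ext
          change θ (i₀ (algebraMap Fq A₀ r)) = algebraMap k E (algebraMap Fq k r)
          rw [hi, hkE]; rfl
        rw [e, AlgHom.commutes, ← IsScalarTower.algebraMap_apply] }
  obtain ⟨xA, hxA0, hxAF⟩ := huniv x₀
  have hxW : ∀ w (hw : w ∈ insert g (T₀.image b)), xA w = x ⟨θ w, hTS' (hθW w hw)⟩ := by
    intro w hw
    obtain ⟨n, c, l, h⟩ := hk w hw
    have e : (⟨θ w, hTS' (hθW w hw)⟩ : Algebra.adjoin k (S : Set E)) =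
        ∑ j, ⟨θ (i₀ (c j)), hTS' (hθi₀ _)⟩ * algebraMap k _ (l j) := by
      apply Subtype.ext
      rw [AddSubmonoidClass.coe_finsetSum]
      change θ w = ∑ j, θ (i₀ (c j)) * algebraMap k E (l j)
      simp only [h, map_sum, map_mul, hkE]
    rw [e, map_sum]
    conv_lhs => rw [h, map_sum]
    refine Finset.sum_congr rfl fun j _ => ?_
    rw [map_mul, map_mul, hxA0, hxAF, AlgHom.commutes]
    rfl
  have hginv : (θ g)⁻¹ ∈ Algebra.adjoin k (S : Set E) :=
    Algebra.subset_adjoin (by simp [S])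
  have hxg : xA g ≠ 0 := by
    rw [hxW g hgW]
    intro h0
    have e : (⟨θ g, hTS' (hθW g hgW)⟩ : Algebra.adjoin k (S : Set E)) * ⟨(θ g)⁻¹, hginv⟩ = 1 :=
      Subtype.ext (mul_inv_cancel₀ hθg)
    have := congrArg x e
    rw [map_mul, h0, zero_mul, map_one] at this
    exact zero_ne_one this
  let xB : B →+* F := IsLocalization.Away.lift g (g := xA) (isUnit_iff_ne_zero.2 hxg)
  have hxB : ∀ a, xB (algebraMap A B a) = xA a := fun a => IsLocalization.Away.lift_eq g _ a
  have hcard : Fintype.card k = Fintype.card Fq ^ Module.finrank Fq k :=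
    Module.card_eq_pow_finrank
  refine ⟨Module.finrank Fq k * n, xB, fun l => by rw [hxB, hxAF], ?_⟩
  let u : A₀ →ₐ[Fq] F := { (xB.comp φ).comp i₀ with
    commutes' := fun r => by
      change xB (φ (i₀ (algebraMap Fq A₀ r))) = _
      rw [hi, hφF, hxB, hxAF] }
  have hu : u = (Fr Fq F (Module.finrank Fq k * n)).comp x₀ := by
    refine AlgHom.ext_of_adjoin_eq_top hT₀ ?_
    intro a ha
    rw [AlgHom.comp_apply, Fr_apply, pow_mul, ← hcard]
    have hθT : θ (i₀ a) ∈ T := Finset.mem_image_of_mem _ ha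
    have hfS : f (θ (i₀ a)) ∈ Algebra.adjoin k (S : Set E) := Algebra.subset_adjoin (by
      simp only [S, Finset.coe_union]
      exact Or.inr (Finset.mem_coe.2 (Finset.mem_image_of_mem _ hθT)))
    refine Eq.trans ?_ (hx _ (hTS hθT) hfS)
    change xB (φ (i₀ a)) = _
    refine mul_right_cancel₀ (pow_ne_zero (t a) hxg) ?_
    rw [← hxB, ← map_pow, ← map_mul, htb, hxB, map_pow, hxB, hxW _ (hbW a ha), hxW g hgW, ← map_pow,
      ← map_mul]
    congr 1
    exact Subtype.ext (hfb a).symm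
  intro a
  have := DFunLike.congr_fun hu a
  rw [AlgHom.comp_apply, Fr_apply] at this
  rw [hxB, hxA0]
  exact this

end QF

namespace QF

open scoped TensorProduct in
theorem tensorcore {Fq F A₀ B : Type*} [Field Fq] [Fintype Fq] [Field F] [Algebra Fq F]
    [IsAlgClosure Fq F] [CommRing A₀] [Algebra Fq A₀] [Algebra.FiniteType Fq A₀]
    (hN : (nilradical (A₀ ⊗[Fq] F)).IsPrime) (g : A₀ ⊗[Fq] F) (hg : ¬ IsNilpotent g)
    [CommRing B] [Algebra (A₀ ⊗[Fq] F) B]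
    [IsLocalization.Away g B] (φ : A₀ ⊗[Fq] F →+* B)
    (hφF : ∀ l : F, φ (1 ⊗ₜ l) = algebraMap (A₀ ⊗[Fq] F) B (1 ⊗ₜ l))
    (hφ : ∀ a, IsNilpotent (φ a) → IsNilpotent a) :
    ∃ (N : ℕ) (x : B →+* F), (∀ l : F, x (algebraMap (A₀ ⊗[Fq] F) B (1 ⊗ₜ l)) = l) ∧
      ∀ a : A₀, x (φ (a ⊗ₜ 1)) =
        x (algebraMap (A₀ ⊗[Fq] F) B (a ⊗ₜ 1)) ^ (Fintype.card Fq ^ N) := by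
  refine ringcore (A := A₀ ⊗[Fq] F) (Algebra.TensorProduct.includeLeftRingHom)
    (Algebra.TensorProduct.includeRight : F →ₐ[Fq] A₀ ⊗[Fq] F).toRingHom ?_ ?_ ?_ ?_ hN g hg φ
    hφF hφ
  · intro r
    change (algebraMap Fq A₀ r) ⊗ₜ[Fq] (1 : F) = (1 : A₀) ⊗ₜ[Fq] (algebraMap Fq F r)
    rw [Algebra.algebraMap_eq_smul_one, Algebra.algebraMap_eq_smul_one, TensorProduct.smul_tmul]
  · intro a
    obtain ⟨S, hS⟩ := TensorProduct.exists_finset a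
    refine ⟨S.card, fun j => (S.equivFin.symm j).1.1, fun j => (S.equivFin.symm j).1.2, ?_⟩
    rw [hS, ← Finset.sum_coe_sort S (fun i => i.1 ⊗ₜ[Fq] i.2), ← S.equivFin.symm.sum_comp]
    refine Finset.sum_congr rfl fun j _ => ?_
    change _ = (_ ⊗ₜ[Fq] (1 : F)) * ((1 : A₀) ⊗ₜ[Fq] _)
    rw [Algebra.TensorProduct.tmul_mul_tmul, one_mul, mul_one]
  · intro τ
    refine ⟨((Algebra.TensorProduct.congr (AlgEquiv.refl : A₀ ≃ₐ[Fq] A₀) τ :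
      A₀ ⊗[Fq] F ≃ₐ[Fq] A₀ ⊗[Fq] F) : A₀ ⊗[Fq] F →+* A₀ ⊗[Fq] F), ?_, ?_, ?_⟩
    · exact (Algebra.TensorProduct.congr (AlgEquiv.refl : A₀ ≃ₐ[Fq] A₀) τ).injective
    · intro a
      change (Algebra.TensorProduct.congr (AlgEquiv.refl : A₀ ≃ₐ[Fq] A₀) τ) (a ⊗ₜ 1) = a ⊗ₜ 1
      simp
    · intro a
      change (Algebra.TensorProduct.congr (AlgEquiv.refl : A₀ ≃ₐ[Fq] A₀) τ) (1 ⊗ₜ a) = 1 ⊗ₜ (τ a)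
      simp
  · intro x₀
    refine ⟨(Algebra.TensorProduct.productMap x₀ (AlgHom.id Fq F)).toRingHom, ?_, ?_⟩
    · intro a
      change Algebra.TensorProduct.productMap x₀ (AlgHom.id Fq F) (a ⊗ₜ 1) = _
      simp
    · intro a
      change Algebra.TensorProduct.productMap x₀ (AlgHom.id Fq F) (1 ⊗ₜ a) = _
      simp

theorem chart {Fq : Type u} [Field Fq] [Fintype Fq]
    (X₀ : Scheme.{u}) (sX₀ : X₀ ⟶ Spec (CommRingCat.of Fq))
    [LocallyOfFiniteType sX₀]
    (fr : X₀ ⟶ X₀) (hfr : IsSchemeFrobenius (Fintype.card Fq) fr) (p : X₀) :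
    ∃ (A₀ : Type u) (_ : CommRing A₀) (_ : Algebra Fq A₀) (_ : Algebra.FiniteType Fq A₀)
      (i : Spec (CommRingCat.of A₀) ⟶ X₀) (_ : IsOpenImmersion i) (σ : A₀ →+* A₀),
      i ≫ sX₀ = Spec.map (CommRingCat.ofHom (algebraMap Fq A₀)) ∧ p ∈ Set.range i ∧
      i ≫ fr = Spec.map (CommRingCat.ofHom σ) ≫ i ∧ ∀ a, σ a = a ^ Fintype.card Fq := by
  obtain ⟨hb, hs⟩ := hfr
  obtain ⟨U, hU, hpU, -⟩ := exists_isAffineOpen_mem_and_subset (x := p) (U := ⊤) trivial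
  let A₀ := Γ(X₀, U)
  let ρ : CommRingCat.of Fq ⟶ A₀ := Spec.preimage (hU.fromSpec ≫ sX₀)
  have hρ : Spec.map ρ = hU.fromSpec ≫ sX₀ := Spec.map_preimage _
  let _ : Algebra Fq A₀ := ρ.hom.toAlgebra
  have hft : LocallyOfFiniteType (Spec.map ρ) := by rw [hρ]; infer_instance
  have hft' : RingHom.FiniteType ρ.hom := HasRingHomProperty.Spec_iff.mp hft
  refine ⟨A₀, inferInstance, inferInstance, hft', hU.fromSpec, inferInstance,
    (fr.appLE U U (fun x hx => show fr.base x ∈ U by rw [hb x]; exact hx)).hom, hρ.symm, ?_, ?_, ?_⟩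
  · rw [hU.range_fromSpec]; exact hpU
  · exact (IsAffineOpen.SpecMap_appLE_fromSpec fr hU hU _).symm
  · exact hs U

theorem iter_affine {A₀ : Type u} [CommRing A₀] {X₀ : Scheme.{u}} (fr : X₀ ⟶ X₀)
    (i : Spec (CommRingCat.of A₀) ⟶ X₀) (σ : A₀ →+* A₀) (q : ℕ)
    (h : i ≫ fr = Spec.map (CommRingCat.ofHom σ) ≫ i) (hσ : ∀ a, σ a = a ^ q) (n : ℕ) :
    ∃ τ : A₀ →+* A₀, i ≫ iterateHom fr n = Spec.map (CommRingCat.ofHom τ) ≫ i ∧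
      ∀ a, τ a = a ^ (q ^ n) := by
  induction n with
  | zero => exact ⟨RingHom.id _, by simp [iterateHom], by simp⟩
  | succ n ih =>
    obtain ⟨τ, h1, h2⟩ := ih
    refine ⟨σ.comp τ, ?_, ?_⟩
    · rw [iterateHom, ← Category.assoc, h, Category.assoc, h1, ← Category.assoc, ← Spec.map_comp]
      rfl
    · intro a
      rw [RingHom.comp_apply, h2, hσ, ← pow_mul, pow_succ]

theorem bce_snd {X₀ S T : Scheme.{u}} (sX₀ : X₀ ⟶ S) (g : T ⟶ S)
    (fr : X₀ ⟶ X₀) (hcomm : fr ≫ sX₀ = sX₀) :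
    baseChangeEnd sX₀ g fr hcomm ≫ pullback.snd sX₀ g = pullback.snd sX₀ g :=
  (pullback.lift_snd _ _ _).trans (Category.comp_id _)

theorem bce_fst {X₀ S T : Scheme.{u}} (sX₀ : X₀ ⟶ S) (g : T ⟶ S)
    (fr : X₀ ⟶ X₀) (hcomm : fr ≫ sX₀ = sX₀) :
    baseChangeEnd sX₀ g fr hcomm ≫ pullback.fst sX₀ g = pullback.fst sX₀ g ≫ fr :=
  pullback.lift_fst _ _ _

theorem iter_snd {X₀ S T : Scheme.{u}} (sX₀ : X₀ ⟶ S) (g : T ⟶ S)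
    (fr : X₀ ⟶ X₀) (hcomm : fr ≫ sX₀ = sX₀) (n : ℕ) :
    iterateHom (baseChangeEnd sX₀ g fr hcomm) n ≫ pullback.snd sX₀ g = pullback.snd sX₀ g := by
  induction n with
  | zero => simp [iterateHom]
  | succ n ih => rw [iterateHom, Category.assoc, ih, bce_snd]

theorem iter_fst {X₀ S T : Scheme.{u}} (sX₀ : X₀ ⟶ S) (g : T ⟶ S)
    (fr : X₀ ⟶ X₀) (hcomm : fr ≫ sX₀ = sX₀) (n : ℕ) :
    iterateHom (baseChangeEnd sX₀ g fr hcomm) n ≫ pullback.fst sX₀ g =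
      pullback.fst sX₀ g ≫ iterateHom fr n := by
  induction n with
  | zero => simp [iterateHom]
  | succ n ih =>
    rw [iterateHom, Category.assoc, ih, ← Category.assoc, bce_fst, Category.assoc]
    rfl

open scoped TensorProduct in
theorem chart2 {Fq F A₀ : Type u} [Field Fq] [Field F] [Algebra Fq F] [CommRing A₀] [Algebra Fq A₀]
    {X₀ : Scheme.{u}} (sX₀ : X₀ ⟶ Spec (CommRingCat.of Fq))
    (i : Spec (CommRingCat.of A₀) ⟶ X₀) [IsOpenImmersion i]
    (hi : i ≫ sX₀ = Spec.map (CommRingCat.ofHom (algebraMap Fq A₀))) :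
    ∃ (j : Spec (CommRingCat.of (A₀ ⊗[Fq] F)) ⟶ pullback sX₀ (specOfAlgebra Fq F)),
      IsOpenImmersion j ∧
      j ≫ pullback.fst sX₀ (specOfAlgebra Fq F) =
        Spec.map (CommRingCat.ofHom Algebra.TensorProduct.includeLeftRingHom) ≫ i ∧
      j ≫ pullback.snd sX₀ (specOfAlgebra Fq F) =
        Spec.map (CommRingCat.ofHom
          (Algebra.TensorProduct.includeRight : F →ₐ[Fq] A₀ ⊗[Fq] F).toRingHom) ∧
      Set.range j = pullback.fst sX₀ (specOfAlgebra Fq F) ⁻¹' Set.range i := by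
  let m := pullback.map (Spec.map (CommRingCat.ofHom (algebraMap Fq A₀))) (specOfAlgebra Fq F)
    sX₀ (specOfAlgebra Fq F) i (𝟙 _) (𝟙 _) ((Category.comp_id _).trans hi.symm)
    ((Category.comp_id _).trans (Category.id_comp _).symm)
  have hm : IsOpenImmersion m := by
    apply MorphismProperty.pullbackMap (P := @IsOpenImmersion)
    · infer_instance
    · infer_instance
    · exact hi.symm
    · simp
  refine ⟨(pullbackSpecIso Fq A₀ F).inv ≫ m, inferInstance, ?_, ?_, ?_⟩
  · rw [Category.assoc]
    simp only [m, pullback.map, pullback.lift_fst]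
    rw [← Category.assoc]
    erw [pullbackSpecIso_inv_fst]
  · rw [Category.assoc]
    simp only [m, pullback.map, pullback.lift_snd, Category.comp_id]
    erw [pullbackSpecIso_inv_snd]
    rfl
  · have h1 : Set.range ((pullbackSpecIso Fq A₀ F).inv ≫ m) = Set.range m := by
      ext z
      constructor
      · rintro ⟨t, rfl⟩
        exact ⟨(pullbackSpecIso Fq A₀ F).inv t, by simp⟩
      · rintro ⟨t, rfl⟩
        refine ⟨(pullbackSpecIso Fq A₀ F).hom t, ?_⟩
        rw [← Scheme.Hom.comp_apply, Iso.hom_inv_id_assoc]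
    rw [h1, Scheme.Pullback.range_map]
    ext z
    simp
end QF

/-- **Corollary 1.3.**  Let `F` be an algebraic closure of `𝔽_q`, let `X⁰` be an irreducible
scheme of finite type over `F` defined over `𝔽_q` (so `X⁰ = X₀ ×_{Spec 𝔽_q} Spec F`), and let
`f : X⁰ ⟶ X⁰` be a dominant morphism.  Then the set of `f`-quasi-fixed points — the images of
the `F`-points `x : Spec F ⟶ X⁰` with `f ∘ x = φ_{q^n} ∘ x` for some `n ∈ ℕ` — is Zariski
dense in `X⁰`. -/
theorem quasiFixed_points_dense
    {Fq F : Type u} [Field Fq] [Fintype Fq] [Field F] [Algebra Fq F] [IsAlgClosure Fq F]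
    -- the `𝔽_q`-model `X₀`, of finite type over `𝔽_q`:
    (X₀ : Scheme.{u}) (sX₀ : X₀ ⟶ Spec (CommRingCat.of Fq))
    [LocallyOfFiniteType sX₀] [QuasiCompact sX₀]
    -- the `q`-power Frobenius of the model:
    (fr : X₀ ⟶ X₀) (hfr : IsSchemeFrobenius (Fintype.card Fq) fr) (hfr₀ : fr ≫ sX₀ = sX₀)
    -- `X⁰ := X₀ ×_{Spec 𝔽_q} Spec F` is of finite type over `F` and irreducible:
    [LocallyOfFiniteType (pullback.snd sX₀ (specOfAlgebra Fq F))]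
    [QuasiCompact (pullback.snd sX₀ (specOfAlgebra Fq F))]
    (hXirr : IrreducibleSpace (pullback sX₀ (specOfAlgebra Fq F) : Scheme.{u}))
    -- `f : X⁰ ⟶ X⁰`, a dominant morphism over `F`:
    (f : (pullback sX₀ (specOfAlgebra Fq F) : Scheme.{u}) ⟶ pullback sX₀ (specOfAlgebra Fq F))
    (hf : f ≫ pullback.snd sX₀ (specOfAlgebra Fq F) = pullback.snd sX₀ (specOfAlgebra Fq F))
    (hdom : DenseRange f.base) :
    Dense {p : ↥(pullback sX₀ (specOfAlgebra Fq F) : Scheme.{u}) |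
      ∃ x : Spec (CommRingCat.of F) ⟶ pullback sX₀ (specOfAlgebra Fq F),
        x ≫ pullback.snd sX₀ (specOfAlgebra Fq F) = 𝟙 (Spec (CommRingCat.of F)) ∧
        (∃ n : ℕ, x ≫ f = x ≫ iterateHom (baseChangeEnd sX₀ (specOfAlgebra Fq F) fr hfr₀) n) ∧
        x.base (IsLocalRing.closedPoint F) = p} := by
  classical
  rw [dense_iff_inter_open]
  intro U hUo hUne
  obtain ⟨p⟩ : Nonempty (pullback sX₀ (specOfAlgebra Fq F) : Scheme.{u}) := inferInstance
  obtain ⟨A₀, _, _, _, i, _, σ, hi, hpi, hifr, hσ⟩ :=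
    QF.chart X₀ sX₀ fr hfr (pullback.fst sX₀ (specOfAlgebra Fq F) p)
  obtain ⟨j, hj, hj1, hj2, hjr⟩ := QF.chart2 (F := F) sX₀ i hi
  have hjo : IsOpen (Set.range j) := j.isOpenEmbedding.isOpen_range
  have hjne : (Set.range j).Nonempty := ⟨p, by rw [hjr]; exact hpi⟩
  have hmeet : ∀ V W : Set (pullback sX₀ (specOfAlgebra Fq F) : Scheme.{u}), IsOpen V → IsOpen W →
      V.Nonempty → W.Nonempty → (V ∩ W).Nonempty := fun V W hV hW h1 h2 =>
    nonempty_preirreducible_inter hV hW h1 h2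
  have hfc : Continuous f := f.continuous
  have hfne : ∀ V : Set (pullback sX₀ (specOfAlgebra Fq F) : Scheme.{u}), IsOpen V → V.Nonempty →
      (f ⁻¹' V).Nonempty := by
    intro V hV hVne
    obtain ⟨z, hz⟩ := hdom.exists_mem_open hV hVne
    exact ⟨z, hz⟩
  -- the nilradical is prime
  have hN : (nilradical (TensorProduct Fq A₀ F)).IsPrime := by
    rw [← PrimeSpectrum.irreducibleSpace_iff_isPrime_nilradical]
    have : PreirreducibleSpace (Spec (CommRingCat.of (TensorProduct Fq A₀ F))) :=
      j.isOpenEmbedding.preirreducibleSpace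
    obtain ⟨_, z, _⟩ := hjne
    exact { this with toNonempty := ⟨z⟩ }
  -- the open set
  have hWo : IsOpen (j ⁻¹' (U ∩ f ⁻¹' Set.range j)) :=
    (hUo.inter (hjo.preimage hfc)).preimage j.continuous
  obtain ⟨_, ⟨w, rfl⟩, hw⟩ := hmeet _ _ hjo (hUo.inter (hjo.preimage hfc)) hjne
    (hmeet _ _ hUo (hjo.preimage hfc) hUne (hfne _ hjo hjne))
  obtain ⟨_, ⟨g, rfl⟩, hwg, hgW⟩ :=
    PrimeSpectrum.isTopologicalBasis_basic_opens.exists_subset_of_mem_open (a := w) hw hWo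
  have hg : ¬ IsNilpotent g := fun h => hwg (by
    obtain ⟨n, hn⟩ := h
    exact w.isPrime.mem_of_pow_mem n (by rw [hn]; exact zero_mem _))
  let B := Localization.Away g
  let l : Spec (CommRingCat.of B) ⟶ Spec (CommRingCat.of (TensorProduct Fq A₀ F)) :=
    Spec.map (CommRingCat.ofHom (algebraMap (TensorProduct Fq A₀ F) B))
  have hl : Set.range l = (PrimeSpectrum.basicOpen g).1 :=
    PrimeSpectrum.localization_away_comap_range B g
  have hrange : Set.range (l ≫ j ≫ f) ⊆ Set.range j := by
    rintro _ ⟨z, rfl⟩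
    have : l z ∈ Set.range l := ⟨z, rfl⟩
    rw [hl] at this
    have := (hgW this).2
    simpa using this
  let φ' := IsOpenImmersion.lift j (l ≫ j ≫ f) hrange
  have hφ' : φ' ≫ j = l ≫ j ≫ f := IsOpenImmersion.lift_fac _ _ _
  obtain ⟨φ, hφ⟩ : ∃ φ : TensorProduct Fq A₀ F →+* B, Spec.map (CommRingCat.ofHom φ) = φ' :=
    ⟨(Spec.preimage φ').hom, Spec.map_preimage φ'⟩
  have hφF : ∀ a : F, φ (TensorProduct.tmul Fq 1 a) =
      algebraMap (TensorProduct Fq A₀ F) B (TensorProduct.tmul Fq 1 a) := by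
    have h1 : φ' ≫ j ≫ pullback.snd sX₀ (specOfAlgebra Fq F) =
        l ≫ j ≫ pullback.snd sX₀ (specOfAlgebra Fq F) := by
      rw [← Category.assoc, hφ', Category.assoc, Category.assoc, hf]
    rw [hj2, ← hφ, ← Spec.map_comp, ← Spec.map_comp] at h1
    have h2 := Spec.map_injective h1
    intro a
    exact congrArg (fun t => t.hom a) h2
  have hφn : ∀ a, IsNilpotent (φ a) → IsNilpotent a := by
    intro a ha
    by_contra hna
    have hDa : (j '' (PrimeSpectrum.basicOpen a : Set (PrimeSpectrum _))).Nonempty := by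
      refine Set.Nonempty.image _ ?_
      by_contra hemp
      replace hemp := Set.not_nonempty_iff_eq_empty.1 hemp
      exact hna (PrimeSpectrum.basicOpen_eq_bot_iff a |>.1 (TopologicalSpace.Opens.ext hemp))
    have hDao : IsOpen (j '' (PrimeSpectrum.basicOpen a : Set (PrimeSpectrum _))) :=
      j.isOpenEmbedding.isOpenMap _ (PrimeSpectrum.basicOpen a).isOpen
    have hDgo : IsOpen (j '' (PrimeSpectrum.basicOpen g : Set (PrimeSpectrum _))) :=
      j.isOpenEmbedding.isOpenMap _ (PrimeSpectrum.basicOpen g).isOpen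
    obtain ⟨_, ⟨z, hz, rfl⟩, z', hz', hzz⟩ := hmeet _ _ hDgo (hDao.preimage hfc) ⟨_, w, hwg, rfl⟩
      (hfne _ hDao hDa)
    replace hz : z ∈ Set.range l := by
      rw [hl]
      exact hz
    obtain ⟨y, rfl⟩ := hz
    have h3 : j (φ' y) = j z' := by
      rw [hzz, ← Scheme.Hom.comp_apply, hφ']
      simp
    have h4 : φ' y = z' := j.isOpenEmbedding.injective h3
    rw [← h4, ← hφ] at hz'
    apply hz'
    change φ a ∈ y.asIdeal
    obtain ⟨n, hn⟩ := ha
    exact y.isPrime.mem_of_pow_mem n (by rw [hn]; exact zero_mem _)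
  obtain ⟨N, x, hx1, hx2⟩ := QF.tensorcore hN g hg φ hφF hφn
  let xs := Spec.map (CommRingCat.ofHom x) ≫ l ≫ j
  refine ⟨xs (IsLocalRing.closedPoint F), ?_, xs, ?_, ⟨N, ?_⟩, rfl⟩
  · have : l (Spec.map (CommRingCat.ofHom x) (IsLocalRing.closedPoint F)) ∈ Set.range l := ⟨_, rfl⟩
    rw [hl] at this
    have := (hgW this).1
    exact this
  · simp only [xs, Category.assoc]
    rw [hj2, ← Spec.map_comp, ← Spec.map_comp, ← Spec.map_id]
    congr 1
    ext a
    exact hx1 a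
  · have hxf : xs ≫ f = Spec.map (CommRingCat.ofHom x) ≫ φ' ≫ j := by
      simp only [xs, Category.assoc]
      rw [hφ']
    apply pullback.hom_ext
    · obtain ⟨τ, hτ, hτ'⟩ := QF.iter_affine fr i σ _ hifr hσ N
      rw [hxf, Category.assoc, Category.assoc, Category.assoc, QF.iter_fst, hj1]
      simp only [xs, Category.assoc]
      rw [← Category.assoc j, hj1, Category.assoc, hτ, ← hφ]
      simp only [l, ← Spec.map_comp_assoc]
      congr 2
      ext a
      change x (φ (TensorProduct.tmul Fq a 1)) =
        x (algebraMap (TensorProduct Fq A₀ F) B (TensorProduct.tmul Fq (τ a) 1))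
      rw [hx2, hτ', ← map_pow, ← map_pow, Algebra.TensorProduct.tmul_pow, one_pow]
    · exact (Category.assoc xs _ _).trans ((congrArg (xs ≫ ·) (hf.trans (QF.iter_snd _ _ _ _ _).symm)).trans
        (Category.assoc xs _ _).symm)
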